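/- arXiv:1312.3378 — 6 statements merged into one kernel-verified Lean document; each statement's English description precedes it below -/
import Mathlib

section
/- Let t : ℝⁿ → [0,∞) be log-concave, bounded and measurable, and let C ∈ ℝⁿˣⁿ be symmetric positive definite. Then the partition function Z(μ) = ∫ N(x;μ,C) t(x) dx is a log-concave function of μ ∈ ℝⁿ. -/
open MeasureTheory Matrix

noncomputable def gaussianD {ι : Type} [Fintype ι] [DecidableEq ι]
    (μ : ι → ℝ) (C : Matrix ι ι ℝ) (x : ι → ℝ) : ℝ :=
  (2 * Real.pi) ^ (-(Fintype.card ι : ℝ) / 2) * C.det ^ (-(1 : ℝ) / 2) *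
    Real.exp (-(1 / 2) * ((x - μ) ⬝ᵥ (C⁻¹ *ᵥ (x - μ))))

open MeasureTheory

open scoped ENNReal Pointwise

/-- The one-dimensional Brunn–Minkowski inequality for nonempty compact sets. -/
lemma volume_add_volume_le_of_isCompact {K L S : Set ℝ} (hK : IsCompact K) (hL : IsCompact L)
    (hKn : K.Nonempty) (hLn : L.Nonempty) (hS : K + L ⊆ S) :
    volume K + volume L ≤ volume S := by
  obtain ⟨a, haK, ha⟩ := hK.exists_isGreatest hKn
  obtain ⟨b, hbL, hb⟩ := hL.exists_isLeast hLn
  have hdisj : AEDisjoint volume ((fun x => x + b) '' K) ((fun x => a + x) '' L) := by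
    refine measure_mono_null (t := {a + b}) ?_ (by simp)
    rintro _ ⟨⟨x, hx, rfl⟩, ⟨y, hy, hxy⟩⟩
    have h₁ := ha hx
    have h₂ := hb hy
    simp only at hxy
    simp only [Set.mem_singleton_iff]
    linarith
  have hLm : MeasurableSet ((fun x => a + x) '' L) :=
    (hL.image (by fun_prop)).isClosed.measurableSet
  calc volume K + volume L
      = volume ((fun x => x + b) '' K) + volume ((fun x => a + x) '' L) := by
        simp [measure_preimage_add_right, measure_preimage_add]
    _ = volume ((fun x => x + b) '' K ∪ (fun x => a + x) '' L) :=
        (measure_union₀ hLm.nullMeasurableSet hdisj).symm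
    _ ≤ volume S := by
        refine measure_mono (Set.union_subset ?_ ?_)
        · rintro _ ⟨x, hx, rfl⟩
          exact hS (Set.add_mem_add hx hbL)
        · rintro _ ⟨x, hx, rfl⟩
          exact hS (Set.add_mem_add haK hx)

lemma measure_eq_biSup_nonempty_isCompact {A : Set ℝ} (hA : MeasurableSet A) (hAn : A.Nonempty) :
    volume A = ⨆ K : Set ℝ, ⨆ _ : K ⊆ A ∧ IsCompact K ∧ K.Nonempty, volume K := by
  obtain ⟨a, ha⟩ := hAn
  refine le_antisymm (le_of_forall_lt fun r hr => ?_) (iSup₂_le fun K hK => measure_mono hK.1)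
  obtain ⟨K, hKA, hK, hrK⟩ := hA.exists_lt_isCompact hr
  exact (hrK.trans_le (measure_mono (Set.subset_insert a K))).trans_le
    (le_iSup₂_of_le (insert a K)
      ⟨Set.insert_subset ha hKA, hK.insert a, Set.insert_nonempty a K⟩ le_rfl)

/-- The one-dimensional Brunn–Minkowski inequality. -/
lemma volume_add_volume_le {A B S : Set ℝ} (hA : MeasurableSet A) (hB : MeasurableSet B)
    (hAn : A.Nonempty) (hBn : B.Nonempty) (hS : A + B ⊆ S) :
    volume A + volume B ≤ volume S := by
  rw [measure_eq_biSup_nonempty_isCompact hA hAn, measure_eq_biSup_nonempty_isCompact hB hBn]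
  obtain ⟨a, ha⟩ := hAn
  obtain ⟨b, hb⟩ := hBn
  refine ENNReal.biSup_add_biSup_le' ⟨{a}, by simpa⟩ ⟨{b}, by simpa⟩ fun K hK L hL => ?_
  exact volume_add_volume_le_of_isCompact hK.2.1 hL.2.1 hK.2.2 hL.2.2
    ((Set.add_subset_add hK.1 hL.1).trans hS)

/-- The one-dimensional Brunn–Minkowski inequality for convex combinations. -/
lemma ofReal_mul_volume_add_le {A B S : Set ℝ} {l : ℝ} (hl0 : 0 < l) (hl1 : l < 1)
    (hA : MeasurableSet A) (hB : MeasurableSet B)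
    (hAn : A.Nonempty) (hBn : B.Nonempty) (hS : l • A + (1 - l) • B ⊆ S) :
    ENNReal.ofReal l * volume A + ENNReal.ofReal (1 - l) * volume B ≤ volume S := by
  have h := volume_add_volume_le (hA.const_smul_of_ne_zero hl0.ne')
    (hB.const_smul_of_ne_zero (sub_pos.2 hl1).ne') hAn.smul_set hBn.smul_set hS
  simpa [Measure.addHaar_smul, abs_of_pos hl0, abs_of_pos (sub_pos.2 hl1)] using h

lemma ENNReal.geom_mean_le_arith_mean_weighted {l : ℝ} (hl0 : 0 < l) (hl1 : l < 1) (x y : ℝ≥0∞) :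
    x ^ l * y ^ (1 - l) ≤ ENNReal.ofReal l * x + ENNReal.ofReal (1 - l) * y := by
  have hl1' : 0 < 1 - l := sub_pos.2 hl1
  have hpq : (l⁻¹).HolderConjugate (1 - l)⁻¹ := by
    rw [Real.holderConjugate_iff]
    exact ⟨(one_lt_inv₀ hl0).2 hl1, by simp⟩
  have h := ENNReal.young_inequality (x ^ l) (y ^ (1 - l)) hpq
  rwa [← ENNReal.rpow_mul, ← ENNReal.rpow_mul, mul_inv_cancel₀ hl0.ne', mul_inv_cancel₀ hl1'.ne',
    ENNReal.rpow_one, ENNReal.rpow_one, ENNReal.ofReal_inv_of_pos hl0,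
    ENNReal.ofReal_inv_of_pos hl1', div_eq_mul_inv, div_eq_mul_inv, inv_inv, inv_inv,
    mul_comm x, mul_comm y] at h

lemma lintegral_eq_lintegral_meas_ofReal_lt {f : ℝ → ℝ≥0∞} (hf : Measurable f)
    (hft : ∀ x, f x ≠ ∞) :
    ∫⁻ x, f x = ∫⁻ s in Set.Ioi (0 : ℝ), volume {x | ENNReal.ofReal s < f x} := by
  have h := lintegral_eq_lintegral_meas_lt (f := fun x => (f x).toReal) volume
    (Filter.Eventually.of_forall fun _ => ENNReal.toReal_nonneg) hf.ennreal_toReal.aemeasurable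
  simp only [ENNReal.ofReal_toReal (hft _)] at h
  rw [h]
  refine setLIntegral_congr_fun measurableSet_Ioi fun s hs => ?_
  simp only [ENNReal.ofReal_lt_iff_lt_toReal (le_of_lt hs) (hft _)]

lemma lt_rpow_mul_rpow_one_sub {l : ℝ} (hl0 : 0 < l) (hl1 : l < 1) {s x y : ℝ≥0∞} (hs : s ≠ 0)
    (hx : s < x) (hy : s < y) : s < x ^ l * y ^ (1 - l) := by
  have hst : s ≠ ∞ := hx.ne_top
  calc s = s ^ l * s ^ (1 - l) := by
        rw [← ENNReal.rpow_add _ _ hs hst]; simp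
    _ < x ^ l * y ^ (1 - l) :=
        ENNReal.mul_lt_mul (ENNReal.rpow_lt_rpow hx hl0)
          (ENNReal.rpow_lt_rpow hy (sub_pos.2 hl1))

/-- Prékopa–Leindler on `ℝ` for functions of supremum one, in arithmetic-mean form. -/
lemma prekopaLeindler_real_of_iSup_eq_one {l : ℝ} (hl0 : 0 < l) (hl1 : l < 1)
    {f g h : ℝ → ℝ≥0∞} (hf : Measurable f) (hg : Measurable g) (hh : Measurable h)
    (hf1 : ⨆ x, f x = 1) (hg1 : ⨆ x, g x = 1)
    (H : ∀ x y, f x ^ l * g y ^ (1 - l) ≤ h (l • x + (1 - l) • y)) :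
    ENNReal.ofReal l * (∫⁻ x, f x) + ENNReal.ofReal (1 - l) * (∫⁻ x, g x) ≤ ∫⁻ x, h x := by
  have hfle : ∀ x, f x ≤ 1 := fun x => hf1 ▸ le_iSup f x
  have hgle : ∀ x, g x ≤ 1 := fun x => hg1 ▸ le_iSup g x
  refine le_trans ?_ (lintegral_mono fun x => min_le_left (h x) 1)
  rw [lintegral_eq_lintegral_meas_ofReal_lt hf fun x => ((hfle x).trans_lt (by simp)).ne,
    lintegral_eq_lintegral_meas_ofReal_lt hg fun x => ((hgle x).trans_lt (by simp)).ne,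
    lintegral_eq_lintegral_meas_ofReal_lt (hh.min measurable_const)
      fun x => ((min_le_right _ _).trans_lt ENNReal.one_lt_top).ne,
    ← lintegral_const_mul' _ _ ENNReal.ofReal_ne_top,
    ← lintegral_const_mul' _ _ ENNReal.ofReal_ne_top]
  refine (le_lintegral_add _ _).trans (setLIntegral_mono' measurableSet_Ioi fun s hs => ?_)
  rcases le_or_gt 1 s with h1 | h1
  · have h1' : (1 : ℝ≥0∞) ≤ ENNReal.ofReal s := by simpa using h1
    have hf0 : {x | ENNReal.ofReal s < f x} = ∅ :=
      Set.eq_empty_of_forall_notMem fun x hx => hx.not_ge ((hfle x).trans h1')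
    have hg0 : {x | ENNReal.ofReal s < g x} = ∅ :=
      Set.eq_empty_of_forall_notMem fun x hx => hx.not_ge ((hgle x).trans h1')
    simp [hf0, hg0]
  · have h1' : ENNReal.ofReal s < 1 := by simpa using h1
    have hs0 : ENNReal.ofReal s ≠ 0 := by simpa using hs
    refine ofReal_mul_volume_add_le hl0 hl1 (measurableSet_lt measurable_const hf)
      (measurableSet_lt measurable_const hg) (lt_iSup_iff.1 (h1'.trans_eq hf1.symm))
      (lt_iSup_iff.1 (h1'.trans_eq hg1.symm)) ?_
    rintro _ ⟨_, ⟨x, hx, rfl⟩, _, ⟨y, hy, rfl⟩, rfl⟩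
    exact lt_min ((lt_rpow_mul_rpow_one_sub hl0 hl1 hs0 hx hy).trans_le (H x y)) h1'

/-- Prékopa–Leindler on `ℝ` for bounded functions. -/
lemma prekopaLeindler_real_of_bounded {l : ℝ} (hl0 : 0 < l) (hl1 : l < 1)
    {f g h : ℝ → ℝ≥0∞} (hf : Measurable f) (hg : Measurable g) (hh : Measurable h)
    (hft : ⨆ x, f x ≠ ∞) (hgt : ⨆ x, g x ≠ ∞)
    (H : ∀ x y, f x ^ l * g y ^ (1 - l) ≤ h (l • x + (1 - l) • y)) :
    (∫⁻ x, f x) ^ l * (∫⁻ x, g x) ^ (1 - l) ≤ ∫⁻ x, h x := by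
  have hl1' : 0 < 1 - l := sub_pos.2 hl1
  by_cases hf0 : ⨆ x, f x = 0
  · simp [ENNReal.iSup_eq_zero.1 hf0, hl0]
  by_cases hg0 : ⨆ x, g x = 0
  · simp [ENNReal.iSup_eq_zero.1 hg0, hl1]
  set a := ⨆ x, f x
  set b := ⨆ x, g x
  have hscale : ∀ x y : ℝ≥0∞, (a⁻¹ * x) ^ l * (b⁻¹ * y) ^ (1 - l) =
      (a ^ l * b ^ (1 - l))⁻¹ * (x ^ l * y ^ (1 - l)) := fun x y => by
    rw [ENNReal.mul_rpow_of_nonneg _ _ hl0.le, ENNReal.mul_rpow_of_nonneg _ _ hl1'.le,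
      ENNReal.inv_rpow, ENNReal.inv_rpow, ENNReal.mul_inv (by simp [hf0, hft]) 
        (by simp [hf0, hft])]
    ring
  have hc0 : a ^ l * b ^ (1 - l) ≠ 0 := by
    simp [hf0, hg0, hft, hgt]
  have hct : a ^ l * b ^ (1 - l) ≠ ∞ :=
    ENNReal.mul_ne_top (ENNReal.rpow_ne_top_of_nonneg hl0.le hft)
      (ENNReal.rpow_ne_top_of_nonneg hl1'.le hgt)
  have key := prekopaLeindler_real_of_iSup_eq_one hl0 hl1 (hf.const_mul a⁻¹) (hg.const_mul b⁻¹)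
    (hh.const_mul (a ^ l * b ^ (1 - l))⁻¹)
    (by rw [← ENNReal.mul_iSup]; exact ENNReal.inv_mul_cancel hf0 hft)
    (by rw [← ENNReal.mul_iSup]; exact ENNReal.inv_mul_cancel hg0 hgt)
    (fun x y => by rw [hscale]; gcongr; exact H x y)
  replace key := (ENNReal.geom_mean_le_arith_mean_weighted hl0 hl1 _ _).trans key
  rw [lintegral_const_mul _ hf, lintegral_const_mul _ hg, lintegral_const_mul _ hh, hscale] at key
  exact (ENNReal.mul_le_mul_iff_right (ENNReal.inv_ne_zero.2 hct)
    (ENNReal.inv_ne_top.2 hc0)).1 key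

lemma lintegral_eq_iSup_lintegral_min_natCast {α : Type*} [MeasurableSpace α] {ν : Measure α}
    {f : α → ℝ≥0∞} (hf : Measurable f) :
    ∫⁻ x, f x ∂ν = ⨆ N : ℕ, ∫⁻ x, min (f x) N ∂ν := by
  rw [← lintegral_iSup (fun N => hf.min measurable_const)
    (fun M N hMN x => min_le_min_left _ (by exact_mod_cast hMN))]
  refine lintegral_congr fun x => ?_
  rw [← inf_iSup_eq, ENNReal.iSup_natCast, inf_top_eq]

/-- Prékopa–Leindler on `ℝ`. -/
lemma prekopaLeindler_real {l : ℝ} (hl0 : 0 < l) (hl1 : l < 1)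
    {f g h : ℝ → ℝ≥0∞} (hf : Measurable f) (hg : Measurable g) (hh : Measurable h)
    (H : ∀ x y, f x ^ l * g y ^ (1 - l) ≤ h (l • x + (1 - l) • y)) :
    (∫⁻ x, f x) ^ l * (∫⁻ x, g x) ^ (1 - l) ≤ ∫⁻ x, h x := by
  have hl1' : 0 < 1 - l := sub_pos.2 hl1
  by_cases hf0 : ∫⁻ x, f x = 0
  · simp [hf0, hl0]
  by_cases hg0 : ∫⁻ x, g x = 0
  · simp [hg0, hl1]
  have hlim : ∀ {u : ℝ → ℝ≥0∞}, Measurable u →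
      Filter.Tendsto (fun N : ℕ => ∫⁻ x, min (u x) N) Filter.atTop (nhds (∫⁻ x, u x)) := by
    intro u hu
    rw [lintegral_eq_iSup_lintegral_min_natCast hu]
    exact tendsto_atTop_iSup fun M N hMN =>
      lintegral_mono fun x => min_le_min_left _ (by exact_mod_cast hMN)
  have hbdd : ∀ (u : ℝ → ℝ≥0∞) (N : ℕ), ⨆ x, min (u x) N ≠ ∞ := fun u N =>
    ((iSup_le fun x => min_le_right _ _).trans_lt (ENNReal.natCast_lt_top N)).ne
  refine le_of_tendsto (ENNReal.Tendsto.mul ((hlim hf).ennrpow_const l)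
    (.inl (by simp [hf0, hl0.le])) ((hlim hg).ennrpow_const (1 - l))
    (.inl (by simp [hg0, hl1.le]))) (Filter.Eventually.of_forall fun N => ?_)
  refine prekopaLeindler_real_of_bounded hl0 hl1 (hf.min measurable_const)
    (hg.min measurable_const) hh (hbdd f N) (hbdd g N) fun x y => le_trans ?_ (H x y)
  gcongr <;> exact min_le_left _ _

lemma lintegral_fin_succ {n : ℕ} {f : (Fin (n + 1) → ℝ) → ℝ≥0∞} (hf : Measurable f) :
    ∫⁻ x, f x = ∫⁻ a : ℝ, ∫⁻ y : Fin n → ℝ, f (Fin.cons a y) := by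
  have e := (volume_preserving_piFinSuccAbove (fun _ : Fin (n + 1) => ℝ) 0).symm
  rw [← e.lintegral_comp hf, Measure.volume_eq_prod, lintegral_prod]
  · simp [MeasurableEquiv.piFinSuccAbove, Fin.consEquiv]
  · exact (hf.comp e.measurable).aemeasurable

/-- The **Prékopa–Leindler inequality**. -/
theorem prekopaLeindler {l : ℝ} (hl0 : 0 < l) (hl1 : l < 1) {n : ℕ}
    {f g h : (Fin n → ℝ) → ℝ≥0∞} (hf : Measurable f) (hg : Measurable g) (hh : Measurable h)
    (H : ∀ x y, f x ^ l * g y ^ (1 - l) ≤ h (l • x + (1 - l) • y)) :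
    (∫⁻ x, f x) ^ l * (∫⁻ x, g x) ^ (1 - l) ≤ ∫⁻ x, h x := by
  induction n with
  | zero =>
    simp only [lintegral_unique, Measure.volume_pi_eq_dirac default, measure_univ, mul_one]
    exact (H _ _).trans_eq (congrArg h (Subsingleton.elim _ _))
  | succ n ih =>
    have hcons : Measurable fun p : ℝ × (Fin n → ℝ) => (Fin.cons p.1 p.2 : Fin (n + 1) → ℝ) :=
      measurable_pi_iff.2 (Fin.cases (by simpa using measurable_fst) fun i => by
        simpa using! (measurable_pi_apply i).comp measurable_snd)
    have hslice : ∀ {u : (Fin (n + 1) → ℝ) → ℝ≥0∞}, Measurable u → ∀ a : ℝ,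
        Measurable fun y : Fin n → ℝ => u (Fin.cons a y) := fun hu a =>
      hu.comp (hcons.comp measurable_prodMk_left)
    rw [lintegral_fin_succ hf, lintegral_fin_succ hg, lintegral_fin_succ hh]
    refine prekopaLeindler_real hl0 hl1 (hf.comp hcons).lintegral_prod_right'
      (hg.comp hcons).lintegral_prod_right' (hh.comp hcons).lintegral_prod_right' fun a b => ?_
    refine ih (hslice hf a) (hslice hg b) (hslice hh _) fun x y => ?_
    refine (H (Fin.cons a x) (Fin.cons b y)).trans_eq (congrArg h ?_)
    ext i
    refine Fin.cases ?_ (fun j => ?_) i <;> simp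

lemma Matrix.PosDef.exists_pos_mul_sum_sq_le {n : ℕ} {A : Matrix (Fin n) (Fin n) ℝ}
    (hA : A.PosDef) : ∃ c > 0, ∀ v : Fin n → ℝ, c * ∑ i, v i ^ 2 ≤ v ⬝ᵥ (A *ᵥ v) := by
  have hcont : Continuous fun v : Fin n → ℝ => v ⬝ᵥ (A *ᵥ v) := by fun_prop
  have hsq : ∀ v : Fin n → ℝ, ∑ i, v i ^ 2 ≤ (n + 1) * ‖v‖ ^ 2 := fun v => by
    calc ∑ i, v i ^ 2 ≤ ∑ _i : Fin n, ‖v‖ ^ 2 := by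
          refine Finset.sum_le_sum fun i _ => ?_
          rw [← sq_abs]
          gcongr
          exact norm_le_pi_norm v i
      _ ≤ (n + 1) * ‖v‖ ^ 2 := by
          simp only [Finset.sum_const, Finset.card_univ, Fintype.card_fin, nsmul_eq_mul]
          gcongr
          linarith
  rcases (Metric.sphere (0 : Fin n → ℝ) 1).eq_empty_or_nonempty with he | hne
  · refine ⟨1, one_pos, fun v => ?_⟩
    have hv : v = 0 := by
      by_contra hv
      refine (Set.ext_iff.1 he (‖v‖⁻¹ • v)).1 ?_
      simp [norm_smul, hv]
    simp [hv]
  · obtain ⟨u, hu, hmin⟩ := (isCompact_sphere _ _).exists_isMinOn hne hcont.continuousOn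
    have hu0 : u ≠ 0 := fun h => by simp [h] at hu
    have hm : 0 < u ⬝ᵥ (A *ᵥ u) := by simpa using hA.dotProduct_mulVec_pos hu0
    refine ⟨u ⬝ᵥ (A *ᵥ u) / (n + 1), by positivity, fun v => ?_⟩
    rcases eq_or_ne v 0 with rfl | hv
    · simp
    have hv' : 0 < ‖v‖ := norm_pos_iff.2 hv
    have h := isMinOn_iff.1 hmin (‖v‖⁻¹ • v) (by simp [norm_smul, hv])
    simp only [mulVec_smul, dotProduct_smul, smul_dotProduct, smul_eq_mul] at h
    calc u ⬝ᵥ (A *ᵥ u) / (n + 1) * ∑ i, v i ^ 2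
        ≤ u ⬝ᵥ (A *ᵥ u) / (n + 1) * ((n + 1) * ‖v‖ ^ 2) := by gcongr; exact hsq v
      _ = u ⬝ᵥ (A *ᵥ u) * ‖v‖ ^ 2 := by field_simp
      _ ≤ ‖v‖⁻¹ * (‖v‖⁻¹ * v ⬝ᵥ (A *ᵥ v)) * ‖v‖ ^ 2 := by gcongr
      _ = v ⬝ᵥ (A *ᵥ v) := by field_simp

lemma measurable_gaussianD {n : ℕ} (μ : Fin n → ℝ) (C : Matrix (Fin n) (Fin n) ℝ) :
    Measurable (gaussianD μ C) := by
  have : Continuous (gaussianD μ C) := by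
    unfold gaussianD
    fun_prop
  exact this.measurable

lemma gaussianD_nonneg {n : ℕ} (μ : Fin n → ℝ) {C : Matrix (Fin n) (Fin n) ℝ} (hC : C.PosDef)
    (x : Fin n → ℝ) : 0 ≤ gaussianD μ C x := by
  have := hC.det_pos
  unfold gaussianD
  positivity

lemma integrable_gaussianD {n : ℕ} (μ : Fin n → ℝ) {C : Matrix (Fin n) (Fin n) ℝ}
    (hC : C.PosDef) : Integrable (gaussianD μ C) := by
  obtain ⟨c, hc, h⟩ := hC.inv.exists_pos_mul_sum_sq_le
  have hprod : Integrable fun x : Fin n → ℝ => ∏ i, Real.exp (-(c / 2) * x i ^ 2) :=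
    Integrable.fintype_prod fun _ => integrable_exp_neg_mul_sq (half_pos hc)
  have hexp : Integrable fun x : Fin n → ℝ => Real.exp (-(1 / 2) * (x ⬝ᵥ (C⁻¹ *ᵥ x))) := by
    refine hprod.mono' (by fun_prop) (Filter.Eventually.of_forall fun x => ?_)
    rw [← Real.exp_sum, ← Finset.mul_sum, Real.norm_eq_abs, Real.abs_exp]
    exact Real.exp_le_exp.2 (by linarith [h x])
  exact (hexp.comp_sub_right μ).const_mul _

lemma Matrix.PosDef.dotProduct_mulVec_convexComb_le {n : ℕ} {A : Matrix (Fin n) (Fin n) ℝ}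
    (hA : A.PosDef) {l : ℝ} (hl0 : 0 ≤ l) (hl1 : l ≤ 1) (u w : Fin n → ℝ) :
    (l • u + (1 - l) • w) ⬝ᵥ (A *ᵥ (l • u + (1 - l) • w)) ≤
      l * (u ⬝ᵥ (A *ᵥ u)) + (1 - l) * (w ⬝ᵥ (A *ᵥ w)) := by
  have h : 0 ≤ (u - w) ⬝ᵥ (A *ᵥ (u - w)) := by
    simpa using hA.posSemidef.dotProduct_mulVec_nonneg (u - w)
  have h' := mul_nonneg (mul_nonneg hl0 (sub_nonneg.2 hl1)) h
  simp only [mulVec_add, mulVec_sub, mulVec_smul, dotProduct_add, add_dotProduct, dotProduct_sub,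
    sub_dotProduct, dotProduct_smul, smul_dotProduct, smul_eq_mul] at h' ⊢
  linarith

/-- The Gaussian density is jointly log-concave in its mean and its argument. -/
lemma gaussianD_rpow_mul_rpow_le {n : ℕ} {C : Matrix (Fin n) (Fin n) ℝ} (hC : C.PosDef)
    {l : ℝ} (hl0 : 0 ≤ l) (hl1 : l ≤ 1) (μ₁ μ₂ x y : Fin n → ℝ) :
    gaussianD μ₁ C x ^ l * gaussianD μ₂ C y ^ (1 - l) ≤
      gaussianD (l • μ₁ + (1 - l) • μ₂) C (l • x + (1 - l) • y) := by
  have hdet := hC.det_pos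
  have hxy : l • x + (1 - l) • y - (l • μ₁ + (1 - l) • μ₂) =
      l • (x - μ₁) + (1 - l) • (y - μ₂) := by module
  have hq := hC.inv.dotProduct_mulVec_convexComb_le hl0 hl1 (x - μ₁) (y - μ₂)
  unfold gaussianD
  rw [hxy]
  set k := (2 * Real.pi) ^ (-(Fintype.card (Fin n) : ℝ) / 2) * C.det ^ (-(1 : ℝ) / 2)
  have hk : 0 < k := by positivity
  rw [Real.mul_rpow hk.le (Real.exp_nonneg _), Real.mul_rpow hk.le (Real.exp_nonneg _),
    ← Real.exp_mul, ← Real.exp_mul, mul_mul_mul_comm, ← Real.rpow_add hk, ← Real.exp_add,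
    add_sub_cancel, Real.rpow_one]
  gcongr
  linarith

/-- The **Prékopa–Leindler inequality** for Bochner integrals of nonnegative functions. -/
theorem prekopaLeindler_integral {l : ℝ} (hl0 : 0 < l) (hl1 : l < 1) {n : ℕ}
    {f g h : (Fin n → ℝ) → ℝ} (hf : Measurable f) (hg : Measurable g) (hh : Measurable h)
    (hf0 : ∀ x, 0 ≤ f x) (hg0 : ∀ x, 0 ≤ g x) (hhi : Integrable h)
    (H : ∀ x y, f x ^ l * g y ^ (1 - l) ≤ h (l • x + (1 - l) • y)) :
    (∫ x, f x) ^ l * (∫ x, g x) ^ (1 - l) ≤ ∫ x, h x := by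
  have hl1' : 0 < 1 - l := sub_pos.2 hl1
  have hh0 : ∀ x, 0 ≤ h x := fun x => by
    have := H x x
    rw [← add_smul, add_sub_cancel, one_smul] at this
    exact (mul_nonneg (Real.rpow_nonneg (hf0 x) _) (Real.rpow_nonneg (hg0 x) _)).trans this
  have key := prekopaLeindler hl0 hl1 hf.ennreal_ofReal hg.ennreal_ofReal hh.ennreal_ofReal
    fun x y => by
      rw [ENNReal.ofReal_rpow_of_nonneg (hf0 x) hl0.le,
        ENNReal.ofReal_rpow_of_nonneg (hg0 y) hl1'.le,
        ← ENNReal.ofReal_mul (Real.rpow_nonneg (hf0 x) _)]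
      exact ENNReal.ofReal_le_ofReal (H x y)
  rw [integral_eq_lintegral_of_nonneg_ae (.of_forall hf0) hf.aestronglyMeasurable,
    integral_eq_lintegral_of_nonneg_ae (.of_forall hg0) hg.aestronglyMeasurable,
    integral_eq_lintegral_of_nonneg_ae (.of_forall hh0) hh.aestronglyMeasurable,
    ENNReal.toReal_rpow, ENNReal.toReal_rpow, ← ENNReal.toReal_mul]
  exact ENNReal.toReal_mono hhi.lintegral_lt_top.ne key

/-- For `t : ℝⁿ → [0,∞)` log-concave, bounded and measurable, and `C`
symmetric positive definite, the partition function `Z(μ) = ∫ N(x;μ,C) t(x) dx` is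
log-concave in `μ`. -/
theorem stmt4 {n : ℕ} (t : (Fin n → ℝ) → ℝ) (ht0 : ∀ x, 0 ≤ t x)
    (htlc : ∀ x y : Fin n → ℝ, ∀ l : ℝ, 0 ≤ l → l ≤ 1 →
      t (l • x + (1 - l) • y) ≥ t x ^ l * t y ^ (1 - l))
    (htb : ∃ M : ℝ, ∀ x, t x ≤ M) (htm : Measurable t)
    (C : Matrix (Fin n) (Fin n) ℝ) (hC : C.PosDef) (hCsymm : C.IsSymm)
    (μ₁ μ₂ : Fin n → ℝ) (l : ℝ) (hl0 : 0 ≤ l) (hl1 : l ≤ 1) :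
    (∫ x : Fin n → ℝ, gaussianD (l • μ₁ + (1 - l) • μ₂) C x * t x) ≥
      (∫ x : Fin n → ℝ, gaussianD μ₁ C x * t x) ^ l *
        (∫ x : Fin n → ℝ, gaussianD μ₂ C x * t x) ^ (1 - l) := by
  obtain ⟨M, hM⟩ := htb
  rcases hl0.eq_or_lt with rfl | hl0'
  · simp
  rcases hl1.eq_or_lt with rfl | hl1'
  · simp
  have hmeas : ∀ μ, Measurable fun x => gaussianD μ C x * t x := fun μ =>
    (measurable_gaussianD μ C).mul htm
  refine prekopaLeindler_integral hl0' hl1' (hmeas μ₁) (hmeas μ₂) (hmeas _)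
    (fun x => mul_nonneg (gaussianD_nonneg μ₁ hC x) (ht0 x))
    (fun x => mul_nonneg (gaussianD_nonneg μ₂ hC x) (ht0 x)) ?_ fun x y => ?_
  · refine (integrable_gaussianD _ hC).mul_bdd (c := M) htm.aestronglyMeasurable
      (.of_forall fun x => ?_)
    rw [Real.norm_eq_abs, abs_of_nonneg (ht0 x)]
    exact hM x
  · rw [Real.mul_rpow (gaussianD_nonneg _ hC x) (ht0 x),
      Real.mul_rpow (gaussianD_nonneg _ hC y) (ht0 y), mul_mul_mul_comm]
    exact mul_le_mul (gaussianD_rpow_mul_rpow_le hC hl0 hl1 μ₁ μ₂ x y) (htlc x y l hl0 hl1)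
      (mul_nonneg (Real.rpow_nonneg (ht0 x) _) (Real.rpow_nonneg (ht0 y) _))
      (gaussianD_nonneg _ hC _)
end

section
/- Let t : ℝⁿ → [0,∞) be log-concave, bounded, measurable, with support of positive Lebesgue measure, and let Σ ∈ ℝⁿˣⁿ be symmetric positive definite and m ∈ ℝⁿ. Set Z = ∫ N(x;m,Σ) t(x) dx, assume the tilted distribution Z⁻¹ t(x) N(x;m,Σ) has finite second moment, and let C be its covariance matrix. Then C is symmetric positive definite, C ⪯ Σ in the Loewner order (i.e., Σ − C is positive semidefinite), and C⁻¹ − Σ⁻¹ is positive semidefinite. -/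
open MeasureTheory Matrix

/-- The one-dimensional Brunn–Minkowski inequality. -/
lemma volume_add_volume_le_of_add_mem {A B H : Set ℝ} (hA : MeasurableSet A)
    (hB : MeasurableSet B) (hAne : A.Nonempty) (hBne : B.Nonempty)
    (hH : ∀ x ∈ A, ∀ y ∈ B, x + y ∈ H) : volume A + volume B ≤ volume H := by
  have compact_case : ∀ K ⊆ A, IsCompact K → K.Nonempty → ∀ L ⊆ B, IsCompact L → L.Nonempty →
      volume K + volume L ≤ volume H := by
    intro K hKA hK hKne L hLB hL hLne
    obtain ⟨a, haK, ha⟩ := hK.exists_isGreatest hKne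
    obtain ⟨b, hbL, hb⟩ := hL.exists_isLeast hLne
    have hK' : volume ((fun x => x + b) '' K) = volume K := by simp
    have hL' : volume ((fun x => a + x) '' L) = volume L := by simp
    have hdisj : AEDisjoint volume ((fun x => x + b) '' K) ((fun x => a + x) '' L) := by
      refine measure_mono_null (t := {a + b}) ?_ (by simp)
      rintro _ ⟨⟨x, hx, rfl⟩, ⟨y, hy, hxy⟩⟩
      have h1 := ha hx
      have h2 := hb hy
      simp only [Set.mem_singleton_iff] at *
      linarith
    rw [← hK', ← hL', ← measure_union₀
      (hL.image (by fun_prop)).measurableSet.nullMeasurableSet hdisj]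
    refine measure_mono (Set.union_subset ?_ ?_)
    · rintro _ ⟨x, hx, rfl⟩
      exact hH x (hKA hx) b (hLB hbL)
    · rintro _ ⟨y, hy, rfl⟩
      exact hH a (hKA haK) y (hLB hy)
  obtain ⟨a, ha⟩ := hAne
  obtain ⟨b, hb⟩ := hBne
  simp_rw [hA.measure_eq_iSup_isCompact, hB.measure_eq_iSup_isCompact, iSup_and']
  refine ENNReal.biSup_add_biSup_le' ⟨∅, by simp⟩ ⟨∅, by simp⟩ fun K ⟨hKA, hK⟩ L ⟨hLB, hL⟩ => ?_
  refine (add_le_add (measure_mono (Set.subset_insert a K))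
    (measure_mono (Set.subset_insert b L))).trans ?_
  exact compact_case _ (Set.insert_subset ha hKA) (hK.insert a) (Set.insert_nonempty _ _)
    _ (Set.insert_subset hb hLB) (hL.insert b) (Set.insert_nonempty _ _)

/-- The one-dimensional Prékopa–Leindler inequality at the midpoint, for functions whose suprema
are normalized to one. -/
lemma lintegral_add_lintegral_le_of_mul_le_sq {f g h : ℝ → ℝ} (hf : Measurable f)
    (hg : Measurable g) (hh : Measurable h) (hf0 : ∀ x, 0 ≤ f x) (hg0 : ∀ x, 0 ≤ g x)
    (hh0 : ∀ x, 0 ≤ h x) (hf1 : IsLUB (Set.range f) 1) (hg1 : IsLUB (Set.range g) 1)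
    (hfgh : ∀ x y, f x * g y ≤ h ((x + y) / 2) ^ 2) :
    (∫⁻ x, ENNReal.ofReal (f x)) + ∫⁻ x, ENNReal.ofReal (g x) ≤
      2 * ∫⁻ x, ENNReal.ofReal (h x) := by
  have layer : ∀ {u : ℝ → ℝ}, Measurable u → (∀ x, 0 ≤ u x) →
      ∫⁻ x, ENNReal.ofReal (u x) = ∫⁻ r in Set.Ioi 0, volume {x | r < u x} := fun hu hu0 =>
    lintegral_eq_lintegral_meas_lt _ (.of_forall hu0) hu.aemeasurable
  have anti : ∀ u : ℝ → ℝ, Measurable fun r => volume {x | r < u x} := fun u =>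
    Antitone.measurable fun r s hrs => measure_mono fun x (hx : s < u x) => hrs.trans_lt hx
  rw [layer hf hf0, layer hg hg0, layer hh hh0, ← lintegral_add_left (anti f),
    ← lintegral_const_mul _ (anti h)]
  refine setLIntegral_mono ((anti h).const_mul 2) fun r (hr : 0 < r) => ?_
  rcases lt_or_ge r 1 with hr1 | hr1
  · obtain ⟨_, ⟨a, rfl⟩, ha⟩ := (lt_isLUB_iff hf1).1 hr1
    obtain ⟨_, ⟨b, rfl⟩, hb⟩ := (lt_isLUB_iff hg1).1 hr1
    have hscale : volume ((fun x : ℝ => x / 2) ⁻¹' {x | r < h x}) = 2 * volume {x | r < h x} := by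
      have := Real.volume_preimage_mul_right (a := (2 : ℝ)⁻¹) (by norm_num) {x | r < h x}
      simpa [div_eq_mul_inv] using this
    rw [← hscale]
    refine volume_add_volume_le_of_add_mem (measurableSet_lt measurable_const hf)
      (measurableSet_lt measurable_const hg) ⟨a, ha⟩ ⟨b, hb⟩ fun x hx y hy => ?_
    have hx' : r < f x := hx
    have hy' : r < g y := hy
    have := hfgh x y
    change r < h ((x + y) / 2)
    refine lt_of_pow_lt_pow_left₀ 2 (hh0 _) ?_
    nlinarith
  · have empty : ∀ u : ℝ → ℝ, IsLUB (Set.range u) 1 → {x | r < u x} = ∅ := fun u hu =>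
      Set.eq_empty_of_forall_notMem fun x hx => absurd (hu.1 ⟨x, rfl⟩) (not_le.2 (hr1.trans_lt hx))
    simp [empty f hf1, empty g hg1]

lemma ENNReal.four_mul_le_add_sq (a b : ENNReal) : 4 * (a * b) ≤ (a + b) ^ 2 := by
  rcases eq_or_ne a ⊤ with rfl | ha
  · simp
  rcases eq_or_ne b ⊤ with rfl | hb
  · simp
  lift a to NNReal using ha
  lift b to NNReal using hb
  norm_cast
  rw [← NNReal.coe_le_coe]
  push_cast
  nlinarith [sq_nonneg ((a : ℝ) - b)]

/-- The one-dimensional Prékopa–Leindler inequality at the midpoint, for bounded functions. -/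
lemma lintegral_mul_lintegral_le_of_mul_le_sq_of_bdd {f g h : ℝ → ℝ} (hf : Measurable f)
    (hg : Measurable g) (hh : Measurable h) (hf0 : ∀ x, 0 ≤ f x) (hg0 : ∀ x, 0 ≤ g x)
    (hh0 : ∀ x, 0 ≤ h x) (hfb : BddAbove (Set.range f)) (hgb : BddAbove (Set.range g))
    (hfgh : ∀ x y, f x * g y ≤ h ((x + y) / 2) ^ 2) :
    (∫⁻ x, ENNReal.ofReal (f x)) * ∫⁻ x, ENNReal.ofReal (g x) ≤
      (∫⁻ x, ENNReal.ofReal (h x)) ^ 2 := by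
  have hfl := isLUB_ciSup hfb
  have hgl := isLUB_ciSup hgb
  set a := ⨆ x, f x
  set b := ⨆ x, g x
  rcases (hf0 0).trans (hfl.1 ⟨0, rfl⟩) |>.eq_or_lt with ha | ha
  · have : ∀ x, f x = 0 := fun x => le_antisymm (ha ▸ hfl.1 ⟨x, rfl⟩) (hf0 x)
    simp [this]
  rcases (hg0 0).trans (hgl.1 ⟨0, rfl⟩) |>.eq_or_lt with hb | hb
  · have : ∀ x, g x = 0 := fun x => le_antisymm (hb ▸ hgl.1 ⟨x, rfl⟩) (hg0 x)
    simp [this]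
  have scale : ∀ {u : ℝ → ℝ} {c : ℝ}, 0 < c → Measurable u →
      ∫⁻ x, ENNReal.ofReal (c⁻¹ * u x) = ENNReal.ofReal c⁻¹ * ∫⁻ x, ENNReal.ofReal (u x) := by
    intro u c hc hu
    simp_rw [ENNReal.ofReal_mul (inv_pos.2 hc).le]
    exact lintegral_const_mul _ hu.ennreal_ofReal
  have lub : ∀ {u : ℝ → ℝ} {c : ℝ}, 0 < c → IsLUB (Set.range u) c →
      IsLUB (Set.range fun x => c⁻¹ * u x) 1 := by
    intro u c hc hu
    have := hu.mul_left (inv_pos.2 hc).le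
    rwa [inv_mul_cancel₀ hc.ne', ← Set.range_comp] at this
  have hab : 0 < √(a * b) := Real.sqrt_pos.2 (mul_pos ha hb)
  have key := lintegral_add_lintegral_le_of_mul_le_sq (hf.const_mul a⁻¹) (hg.const_mul b⁻¹)
    (hh.const_mul (√(a * b))⁻¹) (fun x => mul_nonneg (inv_pos.2 ha).le (hf0 x))
    (fun x => mul_nonneg (inv_pos.2 hb).le (hg0 x))
    (fun x => mul_nonneg (inv_pos.2 hab).le (hh0 x)) (lub ha hfl) (lub hb hgl) (by
      intro x y
      rw [mul_pow, inv_pow, Real.sq_sqrt (mul_pos ha hb).le, mul_inv]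
      have := mul_le_mul_of_nonneg_left (hfgh x y)
        (mul_pos (inv_pos.2 ha) (inv_pos.2 hb)).le
      linarith)
  rw [scale ha hf, scale hb hg, scale hab hh] at key
  set F := ∫⁻ x, ENNReal.ofReal (f x)
  set G := ∫⁻ x, ENNReal.ofReal (g x)
  set H := ∫⁻ x, ENNReal.ofReal (h x)
  have h2 := (ENNReal.four_mul_le_add_sq _ _).trans (pow_le_pow_left' key 2)
  have hc : ENNReal.ofReal (√(a * b))⁻¹ ^ 2 = ENNReal.ofReal a⁻¹ * ENNReal.ofReal b⁻¹ := by
    rw [← ENNReal.ofReal_pow (by positivity), inv_pow, Real.sq_sqrt (mul_pos ha hb).le, mul_inv,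
      ENNReal.ofReal_mul (by positivity)]
  have h3 : (4 * (ENNReal.ofReal a⁻¹ * ENNReal.ofReal b⁻¹)) * (F * G) ≤
      (4 * (ENNReal.ofReal a⁻¹ * ENNReal.ofReal b⁻¹)) * H ^ 2 := by
    rw [mul_pow, mul_pow, hc] at h2
    calc _ = 4 * (ENNReal.ofReal a⁻¹ * F * (ENNReal.ofReal b⁻¹ * G)) := by ring
      _ ≤ _ := h2
      _ = _ := by ring
  refine (ENNReal.mul_le_mul_iff_right ?_ ?_).1 h3
  · simp [ha, hb]
  · finiteness

/-- The one-dimensional Prékopa–Leindler inequality at the midpoint. -/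
lemma lintegral_mul_lintegral_le_of_mul_le_sq {f g h : ℝ → ENNReal} (hf : Measurable f)
    (hg : Measurable g) (hh : Measurable h)
    (hfgh : ∀ x y, f x * g y ≤ h ((x + y) / 2) ^ 2) :
    (∫⁻ x, f x) * ∫⁻ x, g x ≤ (∫⁻ x, h x) ^ 2 := by
  have trunc : ∀ k : ℕ, (∫⁻ x, min (f x) k) * ∫⁻ x, min (g x) k ≤ (∫⁻ x, h x) ^ 2 := by
    intro k
    have htop : ∀ c : ENNReal, min c k ≠ ⊤ := fun c =>
      ((min_le_right _ _).trans_lt (ENNReal.natCast_lt_top k)).ne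
    have bdd : ∀ u : ℝ → ENNReal, BddAbove (Set.range fun x => (min (u x) k).toReal) := by
      intro u
      refine ⟨k, ?_⟩
      rintro _ ⟨x, rfl⟩
      simpa using ENNReal.toReal_mono (ENNReal.natCast_ne_top k) (min_le_right (u x) (k : ENNReal))
    have key := lintegral_mul_lintegral_le_of_mul_le_sq_of_bdd
      (f := fun x => (min (f x) k).toReal) (g := fun x => (min (g x) k).toReal)
      (h := fun x => (min (h x) k).toReal) (by fun_prop) (by fun_prop) (by fun_prop)
      (fun _ => ENNReal.toReal_nonneg) (fun _ => ENNReal.toReal_nonneg)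
      (fun _ => ENNReal.toReal_nonneg) (bdd f) (bdd g) (by
        intro x y
        rw [← ENNReal.toReal_mul, ← ENNReal.toReal_pow]
        refine ENNReal.toReal_mono (ENNReal.pow_ne_top (htop _)) ?_
        rcases min_cases (h ((x + y) / 2)) (k : ENNReal) with hm | hm
        · rw [hm.1]
          exact (mul_le_mul' (min_le_left _ _) (min_le_left _ _)).trans (hfgh x y)
        · rw [hm.1, sq]
          exact mul_le_mul' (min_le_right _ _) (min_le_right _ _))
    simp only [ENNReal.ofReal_toReal (htop _)] at key
    exact key.trans (pow_le_pow_left' (lintegral_mono fun x => min_le_left _ _) 2)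
  have mono : ∀ c : ENNReal, Monotone fun k : ℕ => min c k := fun c i j hij =>
    min_le_min_left _ (by exact_mod_cast hij)
  have lim : ∀ u : ℝ → ENNReal, Measurable u → Filter.Tendsto
      (fun k : ℕ => ∫⁻ x, min (u x) k) Filter.atTop (nhds (∫⁻ x, u x)) := by
    intro u hu
    refine lintegral_tendsto_of_tendsto_of_monotone (fun k => by fun_prop)
      (.of_forall fun x => mono _) (.of_forall fun x => ?_)
    have := (tendsto_const_nhds (x := u x)).min ENNReal.tendsto_nat_nhds_top
    simpa using this
  have hprod : ∀ i j : ℕ, (∫⁻ x, min (f x) i) * ∫⁻ x, min (g x) j ≤ (∫⁻ x, h x) ^ 2 :=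
    fun i j => (mul_le_mul' (lintegral_mono fun x => mono _ (le_max_left i j))
      (lintegral_mono fun x => mono _ (le_max_right i j))).trans (trunc (max i j))
  have sup : ∀ u : ℝ → ENNReal, Measurable u → ∫⁻ x, u x = ⨆ k : ℕ, ∫⁻ x, min (u x) k :=
    fun u hu => tendsto_nhds_unique (lim u hu)
      (tendsto_atTop_iSup fun i j hij => lintegral_mono fun x => mono _ hij)
  rw [sup f hf, sup g hg]
  simp only [ENNReal.iSup_mul, ENNReal.mul_iSup, iSup_le_iff]
  exact fun i j => hprod j i

/-- The Prékopa–Leindler inequality at the midpoint. -/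
theorem lintegral_mul_lintegral_le_of_mul_le_sq_pi {n : ℕ} {f g h : (Fin n → ℝ) → ENNReal}
    (hf : Measurable f) (hg : Measurable g) (hh : Measurable h)
    (hfgh : ∀ x y, f x * g y ≤ h ((1 / 2 : ℝ) • (x + y)) ^ 2) :
    (∫⁻ x, f x) * ∫⁻ x, g x ≤ (∫⁻ x, h x) ^ 2 := by
  induction n with
  | zero =>
    have : ∀ u : (Fin 0 → ℝ) → ENNReal, ∫⁻ x, u x = u 0 := fun u => by
      rw [lintegral_unique, volume_pi, Measure.pi_empty_univ, mul_one]
      congr 1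
      exact Subsingleton.elim _ _
    simpa [this] using hfgh 0 0
  | succ n ih =>
    let φ := (MeasurableEquiv.piFinSuccAbove (fun _ : Fin (n + 1) => ℝ) 0).symm
    have hφ : ∀ z, φ z = Fin.cons z.1 z.2 := fun z => by
      simp [φ, MeasurableEquiv.piFinSuccAbove_symm_apply, Fin.insertNthEquiv]
    have cut : ∀ u : (Fin (n + 1) → ℝ) → ENNReal, Measurable u →
        ∫⁻ x, u x = ∫⁻ a, ∫⁻ y, u (φ (a, y)) := fun u hu => by
      rw [← (volume_preserving_piFinSuccAbove (fun _ : Fin (n + 1) => ℝ) 0).symm.lintegral_comp hu]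
      exact lintegral_prod _ (hu.comp φ.measurable).aemeasurable
    rw [cut f hf, cut g hg, cut h hh]
    have hmeas : ∀ u : (Fin (n + 1) → ℝ) → ENNReal, Measurable u →
        Measurable fun z : ℝ × (Fin n → ℝ) => u (φ z) := fun u hu => hu.comp φ.measurable
    refine lintegral_mul_lintegral_le_of_mul_le_sq (hmeas f hf).lintegral_prod_right'
      (hmeas g hg).lintegral_prod_right' (hmeas h hh).lintegral_prod_right' fun a b => ?_
    refine ih ((hmeas f hf).comp measurable_prodMk_left)
      ((hmeas g hg).comp measurable_prodMk_left) ((hmeas h hh).comp measurable_prodMk_left)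
      fun x y => ?_
    convert hfgh (φ (a, x)) (φ (b, y)) using 3
    rw [hφ, hφ, hφ]
    ext i
    refine Fin.cases ?_ (fun i => ?_) i <;> simp <;> ring

lemma Real.two_add_sq_le_exp_add_exp_neg (a : ℝ) : 2 + a ^ 2 ≤ exp a + exp (-a) := by
  have hcosh : cosh a = 1 + 2 * sinh (a / 2) ^ 2 := by
    have := cosh_two_mul (a / 2)
    rw [cosh_sq, mul_div_cancel₀ a two_ne_zero] at this
    linarith
  have hsinh : (a / 2) ^ 2 ≤ sinh (a / 2) ^ 2 := by
    rcases le_total 0 (a / 2) with h | h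
    · exact pow_le_pow_left₀ h (self_le_sinh_iff.2 h) 2
    · nlinarith [sinh_le_self_iff.2 h]
  rw [cosh_eq] at hcosh
  linarith

lemma le_of_forall_one_add_mul_le_exp {V W : ℝ}
    (h : ∀ u : ℝ, 0 < u → 1 + u * V ≤ Real.exp (u * W)) : V ≤ W := by
  refine le_of_forall_pos_le_add fun ε hε => ?_
  let u := min (1 / (|W| + 1)) (ε / (W ^ 2 + 1))
  have hu : 0 < u := by positivity
  have h1 : u * (|W| + 1) ≤ 1 := (le_div_iff₀ (by positivity)).1 (min_le_left _ _)
  have h2 : u * (W ^ 2 + 1) ≤ ε := (le_div_iff₀ (by positivity)).1 (min_le_right _ _)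
  have hW : |u * W| ≤ 1 := by
    rw [abs_mul, abs_of_pos hu]
    linarith
  have h3 := (abs_le.1 (Real.abs_exp_sub_one_sub_id_le hW)).2
  have h4 := h u hu
  have : u * V ≤ u * (W + ε) := by nlinarith
  exact le_of_mul_le_mul_left this hu

/-- If the opposite exponential tilts of a density `p` by a centered observable `Y` are dominated
at midpoints as for a Gaussian of variance `W`, then the variance of `Y` is at most `W`. -/
theorem integral_mul_sq_le_of_tilt_le {n : ℕ} {p Y : (Fin n → ℝ) → ℝ} {W : ℝ}
    (hpm : Measurable p) (hYm : Measurable Y) (hp0 : ∀ x, 0 ≤ p x) (hpi : Integrable p)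
    (hp1 : ∫ x, p x = 1) (hY1 : Integrable fun x => p x * Y x)
    (hY2 : Integrable fun x => p x * Y x ^ 2) (hY0 : ∫ x, p x * Y x = 0)
    (htilt : ∀ (s : ℝ) (x y : Fin n → ℝ), p x * Real.exp (s * Y x) * (p y * Real.exp (-(s * Y y)))
      ≤ Real.exp (s ^ 2 * W) * p ((1 / 2 : ℝ) • (x + y)) ^ 2) :
    ∫ x, p x * Y x ^ 2 ≤ W := by
  set V := ∫ x, p x * Y x ^ 2 with hV
  have hV0 : 0 ≤ V := integral_nonneg fun x => mul_nonneg (hp0 x) (sq_nonneg _)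
  suffices key : ∀ s : ℝ, 1 + s ^ 2 * V ≤ Real.exp (s ^ 2 * W) from
    le_of_forall_one_add_mul_le_exp fun u hu => by simpa [Real.sq_sqrt hu.le] using key √u
  intro s
  have hf0 : ∀ x, 0 ≤ p x * Real.exp (s * Y x) := fun x => mul_nonneg (hp0 x) (Real.exp_pos _).le
  have hg0 : ∀ x, 0 ≤ p x * Real.exp (-(s * Y x)) :=
    fun x => mul_nonneg (hp0 x) (Real.exp_pos _).le
  have hfm : Measurable fun x => p x * Real.exp (s * Y x) := by fun_prop
  have hgm : Measurable fun x => p x * Real.exp (-(s * Y x)) := by fun_prop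
  have hmass : ∫⁻ x, ENNReal.ofReal (p x) = 1 := by
    rw [← ofReal_integral_eq_lintegral_ofReal hpi (.of_forall hp0), hp1, ENNReal.ofReal_one]
  have hPL := lintegral_mul_lintegral_le_of_mul_le_sq_pi hfm.ennreal_ofReal hgm.ennreal_ofReal
    (hpm.const_mul (Real.exp (s ^ 2 * W / 2))).ennreal_ofReal fun x y => by
      rw [← ENNReal.ofReal_mul (hf0 x), ← ENNReal.ofReal_pow
        (mul_nonneg (Real.exp_pos _).le (hp0 _)), mul_pow, ← Real.exp_nat_mul]
      refine ENNReal.ofReal_le_ofReal ((htilt s x y).trans_eq ?_)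
      congr 2
      push_cast
      ring
  simp_rw [ENNReal.ofReal_mul (Real.exp_pos (s ^ 2 * W / 2)).le] at hPL
  rw [lintegral_const_mul _ hpm.ennreal_ofReal, hmass, mul_one,
    ← ENNReal.ofReal_pow (Real.exp_pos _).le, ← Real.exp_nat_mul,
    show ((2 : ℕ) : ℝ) * (s ^ 2 * W / 2) = s ^ 2 * W by push_cast; ring] at hPL
  have pos : ∀ E : (Fin n → ℝ) → ℝ, Measurable E →
      ∫⁻ x, ENNReal.ofReal (p x * Real.exp (E x)) ≠ 0 := by
    intro E hE h
    rw [lintegral_eq_zero_iff (by fun_prop)] at h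
    have : ∫⁻ x, ENNReal.ofReal (p x) = 0 := by
      rw [lintegral_eq_zero_iff (by fun_prop)]
      filter_upwards [h] with x hx
      simp only [Pi.zero_apply, ENNReal.ofReal_eq_zero] at hx ⊢
      exact nonpos_of_mul_nonpos_left hx (Real.exp_pos _)
    simp [this] at hmass
  have hP0 := pos (fun x => s * Y x) (by fun_prop)
  have hQ0 := pos (fun x => -(s * Y x)) (by fun_prop)
  have hPQ := hPL.trans_lt ENNReal.ofReal_lt_top
  have hPi := (lintegral_ofReal_ne_top_iff_integrable hfm.aestronglyMeasurable
    (.of_forall hf0)).1 (ENNReal.lt_top_of_mul_ne_top_left hPQ.ne hQ0).ne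
  have hQi := (lintegral_ofReal_ne_top_iff_integrable hgm.aestronglyMeasurable
    (.of_forall hg0)).1 (ENNReal.lt_top_of_mul_ne_top_right hPQ.ne hP0).ne
  rw [← ofReal_integral_eq_lintegral_ofReal hPi (.of_forall hf0)] at hPL hP0
  rw [← ofReal_integral_eq_lintegral_ofReal hQi (.of_forall hg0)] at hPL hQ0
  rw [← ENNReal.ofReal_mul (integral_nonneg hf0),
    ENNReal.ofReal_le_ofReal_iff (Real.exp_pos _).le] at hPL
  have hP : 0 < ∫ x, p x * Real.exp (s * Y x) := by simpa using hP0
  have hQ : 0 < ∫ x, p x * Real.exp (-(s * Y x)) := by simpa using hQ0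
  set P := ∫ x, p x * Real.exp (s * Y x) with hPdef
  set Q := ∫ x, p x * Real.exp (-(s * Y x)) with hQdef
  have lower : ∀ c : ℝ, 2 + s ^ 2 * V ≤ Real.exp (-c) * P + Real.exp c * Q := by
    intro c
    calc 2 + s ^ 2 * V ≤ (2 + c ^ 2) * (∫ x, p x) - 2 * s * c * (∫ x, p x * Y x) + s ^ 2 * V := by
          rw [hp1, hY0]
          nlinarith [sq_nonneg c]
      _ = ∫ x, ((2 + c ^ 2) * p x - 2 * s * c * (p x * Y x) + s ^ 2 * (p x * Y x ^ 2)) := by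
          rw [integral_add (f := fun x => (2 + c ^ 2) * p x - 2 * s * c * (p x * Y x))
              ((hpi.const_mul _).sub (hY1.const_mul _)) (hY2.const_mul _),
            integral_sub (hpi.const_mul _) (hY1.const_mul _)]
          simp only [integral_const_mul, hV]
      _ ≤ ∫ x, (Real.exp (-c) * (p x * Real.exp (s * Y x)) +
            Real.exp c * (p x * Real.exp (-(s * Y x)))) := by
          refine integral_mono
            (((hpi.const_mul _).sub (hY1.const_mul _)).add (hY2.const_mul _))
            ((hPi.const_mul _).add (hQi.const_mul _)) fun x => ?_
          have h1 : Real.exp (s * Y x - c) = Real.exp (-c) * Real.exp (s * Y x) := by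
            rw [← Real.exp_add]; ring_nf
          have h2 : Real.exp (-(s * Y x - c)) = Real.exp c * Real.exp (-(s * Y x)) := by
            rw [← Real.exp_add]; ring_nf
          have h3 := mul_le_mul_of_nonneg_left
            (Real.two_add_sq_le_exp_add_exp_neg (s * Y x - c)) (hp0 x)
          rw [h1, h2] at h3
          beta_reduce
          linarith
      _ = _ := by
          rw [integral_add (hPi.const_mul _) (hQi.const_mul _)]
          simp only [integral_const_mul, hPdef, hQdef]
  have hab := lower (Real.log (√P / √Q))
  have hsP := Real.sqrt_pos.2 hP
  have hsQ := Real.sqrt_pos.2 hQ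
  rw [Real.exp_neg, Real.exp_log (div_pos hsP hsQ)] at hab
  have hP2 := Real.sq_sqrt hP.le
  have hQ2 := Real.sq_sqrt hQ.le
  have h1 : (√P / √Q)⁻¹ * P = √P * √Q := by
    nth_rewrite 2 [← hP2]; field_simp
  have h2 : √P / √Q * Q = √P * √Q := by
    nth_rewrite 2 [← hQ2]; field_simp
  rw [h1, h2] at hab
  have h3 : (1 + s ^ 2 * V / 2) ^ 2 ≤ P * Q := by
    rw [← hP2, ← hQ2, ← mul_pow]
    exact pow_le_pow_left₀ (by positivity) (by linarith) 2
  nlinarith [sq_nonneg (s ^ 2 * V / 2)]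

namespace Matrix

variable {ι : Type*} [Fintype ι]

/-- The parallelogram law at the midpoint. -/
lemma dotProduct_mulVec_self_add_dotProduct_mulVec_self (A : Matrix ι ι ℝ) (x y : ι → ℝ) :
    x ⬝ᵥ (A *ᵥ x) + y ⬝ᵥ (A *ᵥ y) =
      2 * (((1 / 2 : ℝ) • (x + y)) ⬝ᵥ (A *ᵥ ((1 / 2 : ℝ) • (x + y)))) +
        (x - y) ⬝ᵥ (A *ᵥ (x - y)) / 2 := by
  simp only [mulVec_sub, mulVec_add, mulVec_smul, dotProduct_sub, sub_dotProduct, dotProduct_add,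
    add_dotProduct, smul_dotProduct, dotProduct_smul, smul_eq_mul]
  ring

lemma volume_setOf_dotProduct_sub_eq_zero {v : ι → ℝ} (hv : v ≠ 0) (e : ι → ℝ) :
    volume {x : ι → ℝ | v ⬝ᵥ (x - e) = 0} = 0 := by
  have h : volume (LinearMap.ker (dotProductBilin ℝ ℝ v) : Set (ι → ℝ)) = 0 := by
    refine Measure.addHaar_submodule _ _ fun htop => hv ?_
    have : v ∈ LinearMap.ker (dotProductBilin ℝ ℝ v) := htop ▸ Submodule.mem_top
    simpa using this
  rw [← measure_preimage_add_right volume (-e)] at h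
  simp only [← sub_eq_add_neg] at h
  exact h

variable [DecidableEq ι]

lemma PosDef.two_mul_dotProduct_le {S : Matrix ι ι ℝ} (hS : S.PosDef) (u d : ι → ℝ) :
    2 * (u ⬝ᵥ d) ≤ u ⬝ᵥ (S *ᵥ u) + d ⬝ᵥ (S⁻¹ *ᵥ d) := by
  have h := hS.inv.posSemidef.dotProduct_mulVec_nonneg (S *ᵥ u - d)
  have hcancel : S⁻¹ *ᵥ (S *ᵥ u) = u := by
    rw [mulVec_mulVec, nonsing_inv_mul _ ((isUnit_iff_isUnit_det _).1 hS.isUnit), one_mulVec]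
  have hsymm : (S *ᵥ u) ⬝ᵥ (S⁻¹ *ᵥ d) = d ⬝ᵥ u := by
    rw [dotProduct_mulVec, ← mulVec_transpose, show S⁻¹ᵀ = S⁻¹ from hS.inv.isHermitian, hcancel,
      dotProduct_comm]
  simp only [star_trivial, mulVec_sub, dotProduct_sub, sub_dotProduct, hcancel, hsymm] at h
  linarith [dotProduct_comm u d, dotProduct_comm u (S *ᵥ u)]

lemma PosDef.posSemidef_inv_sub_inv {A B : Matrix ι ι ℝ} (hA : A.PosDef) (hB : B.PosDef)
    (hAB : (B - A).PosSemidef) : (A⁻¹ - B⁻¹).PosSemidef := by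
  refine .of_dotProduct_mulVec_nonneg (hA.inv.isHermitian.sub hB.inv.isHermitian) fun u => ?_
  have h1 := hA.two_mul_dotProduct_le (B⁻¹ *ᵥ u) u
  have h2 := hAB.dotProduct_mulVec_nonneg (B⁻¹ *ᵥ u)
  have hcancel : B *ᵥ (B⁻¹ *ᵥ u) = u := by
    rw [mulVec_mulVec, mul_nonsing_inv _ ((isUnit_iff_isUnit_det _).1 hB.isUnit), one_mulVec]
  simp only [star_trivial, sub_mulVec, dotProduct_sub, hcancel] at h2 ⊢
  linarith [dotProduct_comm u (B⁻¹ *ᵥ u)]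

lemma PosDef.exists_pos_mul_sum_sq_le_s5 {A : Matrix ι ι ℝ} (hA : A.PosDef) :
    ∃ c : ℝ, 0 < c ∧ ∀ x : ι → ℝ, c * ∑ i, x i ^ 2 ≤ x ⬝ᵥ (A *ᵥ x) := by
  have hdiag : ∀ (x : ι → ℝ) i, x i ^ 2 ≤ A⁻¹ i i * (x ⬝ᵥ (A *ᵥ x)) := by
    intro x i
    have hi : 0 < A⁻¹ i i := hA.inv.diag_pos
    have h := hA.inv.two_mul_dotProduct_le (Pi.single i (x i / A⁻¹ i i)) x
    rw [nonsing_inv_nonsing_inv _ ((isUnit_iff_isUnit_det _).1 hA.isUnit)] at h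
    simp only [mulVec_single, single_dotProduct, Pi.smul_apply, col_apply, op_smul_eq_mul] at h
    have h' : x i ^ 2 / A⁻¹ i i ≤ x ⬝ᵥ (A *ᵥ x) := by
      have e1 : x i / A⁻¹ i i * (A⁻¹ i i * (x i / A⁻¹ i i)) = x i ^ 2 / A⁻¹ i i := by field_simp
      have e2 : x i / A⁻¹ i i * x i = x i ^ 2 / A⁻¹ i i := by ring
      rw [e1, e2] at h
      linarith
    rwa [div_le_iff₀' hi] at h'
  have hT : 0 ≤ ∑ i, A⁻¹ i i := Finset.sum_nonneg fun i _ => hA.inv.posSemidef.diag_nonneg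
  refine ⟨(1 + ∑ i, A⁻¹ i i)⁻¹, by positivity, fun x => ?_⟩
  rw [inv_mul_le_iff₀ (by positivity), add_mul, Finset.sum_mul]
  have hx : 0 ≤ x ⬝ᵥ (A *ᵥ x) := by simpa using hA.posSemidef.dotProduct_mulVec_nonneg x
  linarith [Finset.sum_le_sum fun i (_ : i ∈ Finset.univ) => hdiag x i]

lemma PosDef.integrable_exp {A : Matrix ι ι ℝ} (hA : A.PosDef) :
    Integrable fun x : ι → ℝ => Real.exp (-(1 / 2) * (x ⬝ᵥ (A *ᵥ x))) := by
  obtain ⟨c, hc, h⟩ := hA.exists_pos_mul_sum_sq_le_s5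
  have hprod : Integrable fun x : ι → ℝ => ∏ i, Real.exp (-(c / 2) * x i ^ 2) :=
    Integrable.fintype_prod fun _ => integrable_exp_neg_mul_sq (half_pos hc)
  refine hprod.mono' (Continuous.aestronglyMeasurable
    (by unfold dotProduct mulVec dotProduct; fun_prop)) (.of_forall fun x => ?_)
  rw [Real.norm_of_nonneg (Real.exp_pos _).le, ← Real.exp_sum, Real.exp_le_exp, ← Finset.mul_sum]
  linarith [h x]

end Matrix

section Gaussian

variable {ι : Type} [Fintype ι] [DecidableEq ι] {S : Matrix ι ι ℝ}

lemma gaussianD_pos (hS : S.PosDef) (m x : ι → ℝ) : 0 < gaussianD m S x := by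
  have := hS.det_pos
  unfold gaussianD
  positivity

lemma continuous_gaussianD (m : ι → ℝ) : Continuous (gaussianD m S) := by
  unfold gaussianD dotProduct mulVec dotProduct
  fun_prop

lemma integrable_gaussianD_s5 (hS : S.PosDef) (m : ι → ℝ) : Integrable (gaussianD m S) := by
  unfold gaussianD
  exact (hS.inv.integrable_exp.comp_sub_right m).const_mul _

lemma gaussianD_mul_exp_le (hS : S.PosDef) (m v x y : ι → ℝ) (s : ℝ) :
    gaussianD m S x * gaussianD m S y * Real.exp (s * (v ⬝ᵥ (x - y))) ≤
      Real.exp (s ^ 2 * (v ⬝ᵥ (S *ᵥ v))) * gaussianD m S ((1 / 2 : ℝ) • (x + y)) ^ 2 := by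
  have hq := dotProduct_mulVec_self_add_dotProduct_mulVec_self S⁻¹ (x - m) (y - m)
  rw [show (1 / 2 : ℝ) • (x - m + (y - m)) = (1 / 2 : ℝ) • (x + y) - m by module,
    sub_sub_sub_cancel_right] at hq
  have hd := hS.two_mul_dotProduct_le ((2 * s) • v) (x - y)
  simp only [smul_dotProduct, mulVec_smul, dotProduct_smul, smul_eq_mul] at hd
  unfold gaussianD
  set K := (2 * Real.pi) ^ (-(Fintype.card ι : ℝ) / 2) * S.det ^ (-(1 : ℝ) / 2)
  set z := (1 / 2 : ℝ) • (x + y) - m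
  calc _ = K ^ 2 * Real.exp (-(1 / 2) * ((x - m) ⬝ᵥ (S⁻¹ *ᵥ (x - m))) +
        -(1 / 2) * ((y - m) ⬝ᵥ (S⁻¹ *ᵥ (y - m))) + s * (v ⬝ᵥ (x - y))) := by
        rw [Real.exp_add, Real.exp_add]; ring
    _ ≤ K ^ 2 * Real.exp (s ^ 2 * (v ⬝ᵥ (S *ᵥ v)) + (2 : ℕ) * (-(1 / 2) * (z ⬝ᵥ (S⁻¹ *ᵥ z)))) := by
        refine mul_le_mul_of_nonneg_left (Real.exp_le_exp.2 ?_) (sq_nonneg K)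
        push_cast
        linarith
    _ = _ := by rw [Real.exp_add, Real.exp_nat_mul]; ring

end Gaussian

lemma mul_le_sq_of_logConcave {n : ℕ} {t : (Fin n → ℝ) → ℝ} (ht0 : ∀ x, 0 ≤ t x)
    (htlc : ∀ x y : Fin n → ℝ, ∀ l : ℝ, 0 ≤ l → l ≤ 1 →
      t (l • x + (1 - l) • y) ≥ t x ^ l * t y ^ (1 - l)) (x y : Fin n → ℝ) :
    t x * t y ≤ t ((1 / 2 : ℝ) • (x + y)) ^ 2 := by
  have h := htlc x y (1 / 2) (by norm_num) (by norm_num)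
  rw [show (1 - 1 / 2 : ℝ) = 1 / 2 by norm_num, ← smul_add, ← Real.sqrt_eq_rpow,
    ← Real.sqrt_eq_rpow, ← Real.sqrt_mul (ht0 x)] at h
  exact (Real.sqrt_le_iff.1 h).2

open MeasureTheory

/-- For `t` log-concave, bounded, measurable with support of positive
Lebesgue measure, `S` symmetric positive definite, `m ∈ ℝⁿ`, and the tilted
distribution `Z⁻¹ t(x) N(x;m,S)` having finite second moment with covariance `Cov`,
the matrix `Cov` is (symmetric) positive definite, `Cov ⪯ S` in the Loewner order,
and `Cov⁻¹ - S⁻¹` is positive semidefinite. -/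
theorem stmt5 {n : ℕ} (t : (Fin n → ℝ) → ℝ) (ht0 : ∀ x, 0 ≤ t x)
    (htlc : ∀ x y : Fin n → ℝ, ∀ l : ℝ, 0 ≤ l → l ≤ 1 →
      t (l • x + (1 - l) • y) ≥ t x ^ l * t y ^ (1 - l))
    (htb : ∃ M : ℝ, ∀ x, t x ≤ M) (htm : Measurable t)
    (hts : 0 < volume {x : Fin n → ℝ | 0 < t x})
    (S : Matrix (Fin n) (Fin n) ℝ) (hS : S.PosDef) (hSsymm : S.IsSymm)
    (m : Fin n → ℝ)
    (Z : ℝ) (hZ : Z = ∫ x : Fin n → ℝ, gaussianD m S x * t x)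
    (p : (Fin n → ℝ) → ℝ)
    (hp : p = fun x => Z⁻¹ * (t x * gaussianD m S x))
    (hm1 : Integrable (fun x : Fin n → ℝ => p x • x))
    (e : Fin n → ℝ) (he : e = ∫ x : Fin n → ℝ, p x • x)
    (hm2 : ∀ i j : Fin n,
      Integrable (fun x : Fin n → ℝ => p x * ((x - e) i * (x - e) j)))
    (Cov : Matrix (Fin n) (Fin n) ℝ)
    (hCov : Cov = Matrix.of fun i j =>
      ∫ x : Fin n → ℝ, p x * ((x - e) i * (x - e) j)) :
    Cov.PosDef ∧ (S - Cov).PosSemidef ∧ (Cov⁻¹ - S⁻¹).PosSemidef := by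
  have hNpos := gaussianD_pos hS m
  have hNm : Measurable (gaussianD m S) := (continuous_gaussianD m).measurable
  have htN : Integrable fun x => gaussianD m S x * t x := by
    obtain ⟨M, hM⟩ := htb
    refine (integrable_gaussianD_s5 hS m).mul_bdd (c := M) htm.aestronglyMeasurable
      (.of_forall fun x => ?_)
    rw [Real.norm_of_nonneg (ht0 x)]
    exact hM x
  have hZ0 : 0 < Z := by
    rw [hZ, integral_pos_iff_support_of_nonneg
      (fun x => mul_nonneg (hNpos x).le (ht0 x)) htN]
    refine hts.trans_le (measure_mono fun x (hx : 0 < t x) => ?_)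
    exact (mul_pos (hNpos x) hx).ne'
  have hp0 : ∀ x, 0 ≤ p x := fun x => by
    rw [hp]
    exact mul_nonneg (inv_pos.2 hZ0).le (mul_nonneg (ht0 x) (hNpos x).le)
  have hpm : Measurable p := by
    rw [hp]
    exact (htm.mul hNm).const_mul _
  have hpi : Integrable p := by
    rw [hp]
    simpa only [mul_comm (t _)] using htN.const_mul Z⁻¹
  have hp1 : ∫ x, p x = 1 := by
    simp only [hp, integral_const_mul, mul_comm (t _), ← hZ]
    exact inv_mul_cancel₀ hZ0.ne'
  have hquad : ∀ v x : Fin n → ℝ, p x * (v ⬝ᵥ (x - e)) ^ 2 =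
      ∑ i, ∑ j, v i * v j * (p x * ((x - e) i * (x - e) j)) := fun v x => by
    rw [sq, dotProduct, Finset.sum_mul_sum, Finset.mul_sum]
    refine Finset.sum_congr rfl fun i _ => ?_
    rw [Finset.mul_sum]
    exact Finset.sum_congr rfl fun j _ => by ring
  have hY2 : ∀ v : Fin n → ℝ, Integrable fun x => p x * (v ⬝ᵥ (x - e)) ^ 2 := fun v => by
    simp only [hquad]
    exact integrable_finsetSum _ fun i _ => integrable_finsetSum _ fun j _ =>
      (hm2 i j).const_mul _
  have hCovquad : ∀ v : Fin n → ℝ, v ⬝ᵥ (Cov *ᵥ v) = ∫ x, p x * (v ⬝ᵥ (x - e)) ^ 2 := fun v => by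
    simp only [hquad]
    rw [integral_finsetSum _ fun i _ => integrable_finsetSum _ fun j _ =>
      (hm2 i j).const_mul _]
    simp only [dotProduct, mulVec, hCov, of_apply, Finset.mul_sum]
    refine Finset.sum_congr rfl fun i _ => ?_
    rw [integral_finsetSum _ fun j _ => (hm2 i j).const_mul _]
    refine Finset.sum_congr rfl fun j _ => ?_
    rw [integral_const_mul]
    ring
  have hCovherm : Cov.IsHermitian := by
    ext i j
    simp only [conjTranspose_apply, star_trivial, hCov, of_apply, mul_comm ((_ - e) i)]
  have hCovpos : Cov.PosDef := by
    refine .of_dotProduct_mulVec_pos hCovherm fun v hv => ?_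
    rw [star_trivial, hCovquad, integral_pos_iff_support_of_nonneg
      (fun x => mul_nonneg (hp0 x) (sq_nonneg _)) (hY2 v)]
    refine hts.trans_le ?_
    rw [← measure_sdiff_null (volume_setOf_dotProduct_sub_eq_zero hv e)]
    refine measure_mono fun x ⟨(hx : 0 < t x), hxv⟩ => mul_ne_zero ?_ (pow_ne_zero 2 hxv)
    rw [hp]
    exact (mul_pos (inv_pos.2 hZ0) (mul_pos hx (hNpos x))).ne'
  have hle : ∀ v : Fin n → ℝ, ∫ x, p x * (v ⬝ᵥ (x - e)) ^ 2 ≤ v ⬝ᵥ (S *ᵥ v) := by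
    intro v
    let φ : (Fin n → ℝ) →L[ℝ] ℝ := (dotProductBilin ℝ ℝ v).toContinuousLinearMap
    have hφ : ∀ x, φ x = v ⬝ᵥ x := fun _ => rfl
    have hYeq : ∀ x, p x * (v ⬝ᵥ (x - e)) = φ (p x • x) - p x * (v ⬝ᵥ e) := fun x => by
      rw [hφ, dotProduct_sub, dotProduct_smul, smul_eq_mul]
      ring
    have hφi : Integrable fun x => φ (p x • x) := φ.integrable_comp hm1
    refine integral_mul_sq_le_of_tilt_le hpm (by unfold dotProduct; fun_prop) hp0 hpi hp1
      ?_ (hY2 v) ?_ fun s x y => ?_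
    · simp only [hYeq]
      exact hφi.sub (hpi.mul_const _)
    · simp only [hYeq]
      rw [integral_sub hφi (hpi.mul_const _), φ.integral_comp_comm hm1, ← he, integral_mul_const,
        hp1, hφ, one_mul, sub_self]
    · have h1 := mul_le_sq_of_logConcave ht0 htlc x y
      have h2 := gaussianD_mul_exp_le hS m v x y s
      have h3 : Real.exp (s * (v ⬝ᵥ (x - e))) * Real.exp (-(s * (v ⬝ᵥ (y - e)))) =
          Real.exp (s * (v ⬝ᵥ (x - y))) := by
        rw [← Real.exp_add]
        simp only [dotProduct_sub]
        ring_nf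
      simp only [hp]
      calc _ = Z⁻¹ ^ 2 * ((t x * t y) * (gaussianD m S x * gaussianD m S y *
            Real.exp (s * (v ⬝ᵥ (x - y))))) := by rw [← h3]; ring
        _ ≤ Z⁻¹ ^ 2 * (t ((1 / 2 : ℝ) • (x + y)) ^ 2 * (Real.exp (s ^ 2 * (v ⬝ᵥ (S *ᵥ v))) *
            gaussianD m S ((1 / 2 : ℝ) • (x + y)) ^ 2)) := by
          have := hNpos x
          have := hNpos y
          gcongr
        _ = _ := by ring
  have hsub : (S - Cov).PosSemidef := by
    refine .of_dotProduct_mulVec_nonneg (hS.isHermitian.sub hCovherm) fun v => ?_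
    rw [star_trivial, sub_mulVec, dotProduct_sub, hCovquad]
    exact sub_nonneg.2 (hle v)
  exact ⟨hCovpos, hsub, hCovpos.posSemidef_inv_sub_inv hS hsub⟩
end

section
/- Let f : ℝⁿ × ℝᵐ → [0,∞) be log-concave, bounded and measurable. Then the marginalized function g(x) = ∫_{ℝᵐ} f(x,y) dy is log-concave on ℝⁿ (whenever the integrals are finite). -/
open MeasureTheory Matrix
open MeasureTheory
open scoped ENNReal

/-- The Prékopa–Leindler inequality with weight `l`, as a property of the measure `μ`. -/
def PrekopaLeindler {E : Type*} [AddCommGroup E] [Module ℝ E] [MeasurableSpace E]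
    (l : ℝ) (μ : Measure E) : Prop :=
  ∀ F G H : E → ℝ≥0∞, Measurable F → Measurable G → Measurable H →
    (∀ x y, F x ^ l * G y ^ (1 - l) ≤ H (l • x + (1 - l) • y)) →
    (∫⁻ x, F x ∂μ) ^ l * (∫⁻ x, G x ∂μ) ^ (1 - l) ≤ ∫⁻ x, H x ∂μ

theorem PrekopaLeindler.prod {E E' : Type*} [AddCommGroup E] [Module ℝ E] [MeasurableSpace E]
    [AddCommGroup E'] [Module ℝ E'] [MeasurableSpace E'] {l : ℝ} {μ : Measure E} {ν : Measure E'}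
    [SFinite μ] [SFinite ν] (hμ : PrekopaLeindler l μ) (hν : PrekopaLeindler l ν) :
    PrekopaLeindler l (μ.prod ν) := by
  intro F G H hF hG hH h
  rw [lintegral_prod _ hF.aemeasurable, lintegral_prod _ hG.aemeasurable,
    lintegral_prod _ hH.aemeasurable]
  refine hμ _ _ _ hF.lintegral_prod_right' hG.lintegral_prod_right' hH.lintegral_prod_right' ?_
  intro x y
  refine hν _ _ _ (hF.comp measurable_prodMk_left) (hG.comp measurable_prodMk_left)
    (hH.comp measurable_prodMk_left) ?_
  intro a b
  exact h (x, a) (y, b)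

theorem PrekopaLeindler.of_linearEquiv {E E' : Type*} [AddCommGroup E] [Module ℝ E]
    [MeasurableSpace E] [AddCommGroup E'] [Module ℝ E'] [MeasurableSpace E'] {l : ℝ}
    {μ : Measure E} {ν : Measure E'} (hμ : PrekopaLeindler l μ) (e : E →ₗ[ℝ] E')
    (he : MeasurePreserving e μ ν) : PrekopaLeindler l ν := by
  intro F G H hF hG hH h
  rw [← he.lintegral_comp hF, ← he.lintegral_comp hG, ← he.lintegral_comp hH]
  refine hμ _ _ _ (hF.comp he.measurable) (hG.comp he.measurable) (hH.comp he.measurable) ?_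
  intro x y
  simpa using h (e x) (e y)

theorem IsCompact.volume_add_le_volume {K L C : Set ℝ} (hK : IsCompact K) (hL : IsCompact L)
    (hK0 : K.Nonempty) (hL0 : L.Nonempty) (h : ∀ a ∈ K, ∀ b ∈ L, a + b ∈ C) :
    volume K + volume L ≤ volume C := by
  obtain ⟨p, hp, hpK⟩ := hK.exists_isGreatest hK0
  obtain ⟨q, hq, hqL⟩ := hL.exists_isLeast hL0
  have hd : AEDisjoint volume ((fun x => x + q) '' K) ((fun x => p + x) '' L) := by
    refine measure_mono_null (t := {p + q}) ?_ (by simp)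
    rintro _ ⟨⟨a, ha, rfl⟩, ⟨b, hb, hab⟩⟩
    have h1 := hpK ha
    have h2 := hqL hb
    simp only at hab
    simp only [Set.mem_singleton_iff]
    linarith
  have hm : MeasurableSet ((fun x => p + x) '' L) :=
    (hL.image (by fun_prop)).measurableSet
  calc volume K + volume L
      = volume ((fun x => x + q) '' K) + volume ((fun x => p + x) '' L) := by
        simp [Set.image_add_right, Set.image_add_left]
    _ = volume ((fun x => x + q) '' K ∪ (fun x => p + x) '' L) :=
        (measure_union₀ hm.nullMeasurableSet hd).symm
    _ ≤ volume C := by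
        refine measure_mono (Set.union_subset ?_ ?_)
        · rintro _ ⟨a, ha, rfl⟩
          exact h a ha q hq
        · rintro _ ⟨b, hb, rfl⟩
          exact h p hp b hb

/-- The one-dimensional Brunn–Minkowski inequality. -/
theorem Real.volume_add_le_volume {A B C : Set ℝ} (hA : MeasurableSet A) (hB : MeasurableSet B)
    (hA0 : A.Nonempty) (hB0 : B.Nonempty) (h : ∀ a ∈ A, ∀ b ∈ B, a + b ∈ C) :
    volume A + volume B ≤ volume C := by
  obtain ⟨a, ha⟩ := hA0
  obtain ⟨b, hb⟩ := hB0
  rw [hA.measure_eq_iSup_isCompact, hB.measure_eq_iSup_isCompact]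
  simp only [iSup_and']
  refine ENNReal.biSup_add_biSup_le' (p := fun K => K ⊆ A ∧ IsCompact K)
    (q := fun K => K ⊆ B ∧ IsCompact K) ⟨∅, by simp⟩ ⟨∅, by simp⟩ ?_
  rintro K ⟨hKA, hK⟩ L ⟨hLB, hL⟩
  have hKA' : insert a K ⊆ A := Set.insert_subset ha hKA
  have hLB' : insert b L ⊆ B := Set.insert_subset hb hLB
  calc volume K + volume L ≤ volume (insert a K) + volume (insert b L) := by
        gcongr <;> exact Set.subset_insert _ _
    _ ≤ volume C := (hK.insert a).volume_add_le_volume (hL.insert b) ⟨a, by simp⟩ ⟨b, by simp⟩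
        fun x hx y hy => h x (hKA' hx) y (hLB' hy)

theorem Real.volume_smul_add_smul_le_volume {A B C : Set ℝ} {l : ℝ} (hl0 : 0 < l) (hl1 : l < 1)
    (hA : MeasurableSet A) (hB : MeasurableSet B) (hA0 : A.Nonempty) (hB0 : B.Nonempty)
    (h : ∀ a ∈ A, ∀ b ∈ B, l • a + (1 - l) • b ∈ C) :
    ENNReal.ofReal l * volume A + ENNReal.ofReal (1 - l) * volume B ≤ volume C := by
  have h1 : 0 < 1 - l := sub_pos.2 hl1
  have := Real.volume_add_le_volume (C := C) (hA.const_smul₀ l) (hB.const_smul₀ (1 - l))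
    (hA0.smul_set (a := l)) (hB0.smul_set (a := 1 - l)) (by
      rintro _ ⟨a, ha, rfl⟩ _ ⟨b, hb, rfl⟩
      exact h a ha b hb)
  simpa [Measure.addHaar_smul, abs_of_pos hl0, abs_of_pos h1] using this

theorem lintegral_eq_setLIntegral_Ioo_meas_lt {F : ℝ → ℝ≥0∞} (hF : Measurable F)
    (hF1 : ∀ x, F x ≤ 1) :
    ∫⁻ x, F x = ∫⁻ t in Set.Ioo (0 : ℝ) 1, volume {x | ENNReal.ofReal t < F x} := by
  have hfin : ∀ x, F x ≠ ∞ := fun x => ((hF1 x).trans_lt ENNReal.one_lt_top).ne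
  have key := lintegral_eq_lintegral_meas_lt (volume : Measure ℝ) (f := fun x => (F x).toReal)
    (.of_forall fun x => ENNReal.toReal_nonneg) hF.ennreal_toReal.aemeasurable
  simp only [ENNReal.ofReal_toReal (hfin _)] at key
  rw [key, ← Set.Ioo_union_Ici_eq_Ioi (zero_lt_one' ℝ),
    lintegral_union measurableSet_Ici
      (Set.disjoint_left.2 fun x hx hx' => not_le.2 hx.2 hx')]
  have hz : ∫⁻ t in Set.Ici (1 : ℝ), volume {x | t < (F x).toReal} = 0 := by
    rw [setLIntegral_congr_fun (g := fun _ => 0) measurableSet_Ici, lintegral_zero]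
    intro t ht
    have : {x | t < (F x).toReal} = ∅ := by
      ext x
      simp only [Set.mem_ofPred_eq, Set.mem_empty_iff_false, iff_false, not_lt]
      exact (ENNReal.toReal_mono ENNReal.one_ne_top (hF1 x)).trans (by simpa using ht)
    simp [this]
  rw [hz, add_zero]
  refine setLIntegral_congr_fun measurableSet_Ioo fun t ht => ?_
  simp only [ENNReal.ofReal_lt_iff_lt_toReal ht.1.le (hfin _)]

theorem ENNReal.rpow_mul_rpow_le_add {l : ℝ} (hl0 : 0 < l) (hl1 : l < 1) (a b : ℝ≥0∞) :
    a ^ l * b ^ (1 - l) ≤ ENNReal.ofReal l * a + ENNReal.ofReal (1 - l) * b := by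
  have h1 : 0 < 1 - l := sub_pos.2 hl1
  have hpq : (l⁻¹).HolderConjugate ((1 - l)⁻¹) := by
    rw [Real.holderConjugate_iff]
    exact ⟨(one_lt_inv₀ hl0).2 hl1, by simp⟩
  have := ENNReal.young_inequality (a ^ l) (b ^ (1 - l)) hpq
  rw [← ENNReal.rpow_mul, ← ENNReal.rpow_mul, mul_inv_cancel₀ hl0.ne', mul_inv_cancel₀ h1.ne',
    ENNReal.rpow_one, ENNReal.rpow_one, ENNReal.ofReal_inv_of_pos hl0,
    ENNReal.ofReal_inv_of_pos h1, ENNReal.div_eq_inv_mul, ENNReal.div_eq_inv_mul, inv_inv,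
    inv_inv] at this
  exact this

theorem Real.prekopaLeindler_of_iSup_eq_one {l : ℝ} (hl0 : 0 < l) (hl1 : l < 1)
    {F G H : ℝ → ℝ≥0∞} (hF : Measurable F) (hG : Measurable G) (hH : Measurable H)
    (hF1 : ⨆ x, F x = 1) (hG1 : ⨆ x, G x = 1)
    (h : ∀ x y, F x ^ l * G y ^ (1 - l) ≤ H (l • x + (1 - l) • y)) :
    (∫⁻ x, F x) ^ l * (∫⁻ x, G x) ^ (1 - l) ≤ ∫⁻ x, H x := by
  have h1 : 0 < 1 - l := sub_pos.2 hl1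
  have hFle : ∀ x, F x ≤ 1 := fun x => hF1 ▸ le_iSup F x
  have hGle : ∀ x, G x ≤ 1 := fun x => hG1 ▸ le_iSup G x
  have hmin : ∫⁻ x, min (H x) 1 ≤ ∫⁻ x, H x := lintegral_mono fun x => min_le_left _ _
  refine (ENNReal.rpow_mul_rpow_le_add hl0 hl1 _ _).trans (le_trans ?_ hmin)
  rw [lintegral_eq_setLIntegral_Ioo_meas_lt hF hFle, lintegral_eq_setLIntegral_Ioo_meas_lt hG hGle,
    lintegral_eq_setLIntegral_Ioo_meas_lt (hH.min measurable_const) fun x => min_le_right _ _,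
    ← lintegral_const_mul' _ _ ENNReal.ofReal_ne_top,
    ← lintegral_const_mul' _ _ ENNReal.ofReal_ne_top]
  refine (le_lintegral_add _ _).trans (setLIntegral_mono' measurableSet_Ioo fun t ht => ?_)
  have ht1 : ENNReal.ofReal t < 1 := by simpa using ht.2
  have hFne : {x | ENNReal.ofReal t < F x}.Nonempty := by
    obtain ⟨x, hx⟩ := lt_iSup_iff.1 (ht1.trans_eq hF1.symm)
    exact ⟨x, hx⟩
  have hGne : {x | ENNReal.ofReal t < G x}.Nonempty := by
    obtain ⟨x, hx⟩ := lt_iSup_iff.1 (ht1.trans_eq hG1.symm)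
    exact ⟨x, hx⟩
  refine Real.volume_smul_add_smul_le_volume hl0 hl1 (measurableSet_lt measurable_const hF)
    (measurableSet_lt measurable_const hG) hFne
    hGne fun x hx y hy => lt_min ?_ ht1
  refine lt_of_lt_of_le ?_ (h x y)
  calc ENNReal.ofReal t = ENNReal.ofReal t ^ l * ENNReal.ofReal t ^ (1 - l) := by
        rw [← ENNReal.rpow_add_of_nonneg _ _ hl0.le h1.le]; simp
    _ < F x ^ l * G y ^ (1 - l) :=
        ENNReal.mul_lt_mul (ENNReal.rpow_lt_rpow hx hl0) (ENNReal.rpow_lt_rpow hy h1)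

theorem Real.prekopaLeindler_of_iSup_ne_top {l : ℝ} (hl0 : 0 < l) (hl1 : l < 1)
    {F G H : ℝ → ℝ≥0∞} (hF : Measurable F) (hG : Measurable G) (hH : Measurable H)
    (hFtop : ⨆ x, F x ≠ ∞) (hGtop : ⨆ x, G x ≠ ∞)
    (h : ∀ x y, F x ^ l * G y ^ (1 - l) ≤ H (l • x + (1 - l) • y)) :
    (∫⁻ x, F x) ^ l * (∫⁻ x, G x) ^ (1 - l) ≤ ∫⁻ x, H x := by
  have h1 : 0 < 1 - l := sub_pos.2 hl1
  set A := ⨆ x, F x with hA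
  set B := ⨆ x, G x with hB
  rcases eq_or_ne A 0 with hA0 | hA0
  · have : ∀ x, F x = 0 := fun x => le_antisymm (hA0 ▸ le_iSup F x) bot_le
    simp [this, hl0]
  rcases eq_or_ne B 0 with hB0 | hB0
  · have : ∀ x, G x = 0 := fun x => le_antisymm (hB0 ▸ le_iSup G x) bot_le
    simp [this, hl1]
  set c := A⁻¹ ^ l * B⁻¹ ^ (1 - l) with hc
  have hmul : ∀ a b : ℝ≥0∞, (A⁻¹ * a) ^ l * (B⁻¹ * b) ^ (1 - l) = c * (a ^ l * b ^ (1 - l)) := by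
    intro a b
    rw [ENNReal.mul_rpow_of_nonneg _ _ hl0.le, ENNReal.mul_rpow_of_nonneg _ _ h1.le, hc]
    ring
  have hAi : A⁻¹ ≠ 0 := ENNReal.inv_ne_zero.2 hFtop
  have hBi : B⁻¹ ≠ 0 := ENNReal.inv_ne_zero.2 hGtop
  have hAi' : A⁻¹ ≠ ∞ := ENNReal.inv_ne_top.2 hA0
  have hBi' : B⁻¹ ≠ ∞ := ENNReal.inv_ne_top.2 hB0
  have hc0 : c ≠ 0 := mul_ne_zero (ENNReal.rpow_pos hAi.bot_lt hAi').ne'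
    (ENNReal.rpow_pos hBi.bot_lt hBi').ne'
  have hctop : c ≠ ∞ := ENNReal.mul_ne_top (ENNReal.rpow_ne_top_of_nonneg hl0.le hAi')
    (ENNReal.rpow_ne_top_of_nonneg h1.le hBi')
  have key := Real.prekopaLeindler_of_iSup_eq_one hl0 hl1 (F := fun x => A⁻¹ * F x)
    (G := fun x => B⁻¹ * G x) (H := fun x => c * H x) (hF.const_mul _) (hG.const_mul _)
    (hH.const_mul _) (by rw [← ENNReal.mul_iSup]; exact ENNReal.inv_mul_cancel hA0 hFtop)
    (by rw [← ENNReal.mul_iSup]; exact ENNReal.inv_mul_cancel hB0 hGtop)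
    (fun x y => by rw [hmul]; gcongr; exact h x y)
  rw [lintegral_const_mul _ hF, lintegral_const_mul _ hG, lintegral_const_mul _ hH, hmul] at key
  exact (ENNReal.mul_le_mul_iff_right hc0 hctop).1 key

theorem lintegral_eq_iSup_lintegral_min_natCast_s9 {F : ℝ → ℝ≥0∞} (hF : Measurable F) :
    ∫⁻ x, F x = ⨆ k : ℕ, ∫⁻ x, min (F x) k := by
  rw [← lintegral_iSup (fun k => hF.min measurable_const)
    (fun i j hij x => min_le_min_left _ (by exact_mod_cast hij))]
  refine lintegral_congr fun x => ?_
  rw [← inf_iSup_eq, ENNReal.iSup_natCast, inf_top_eq]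

theorem Real.prekopaLeindler {l : ℝ} (hl0 : 0 < l) (hl1 : l < 1) :
    PrekopaLeindler l (volume : Measure ℝ) := by
  intro F G H hF hG hH h
  have h1 : 0 < 1 - l := sub_pos.2 hl1
  have hsup : ∀ (F : ℝ → ℝ≥0∞) (k : ℕ), ⨆ x, min (F x) (k : ℝ≥0∞) ≠ ∞ := fun F k =>
    ((iSup_le fun x => min_le_right _ _).trans_lt (ENNReal.natCast_lt_top k)).ne
  have hpow : ∀ {s : ℝ} (_ : 0 < s) (u : ℕ → ℝ≥0∞), (⨆ k, u k) ^ s = ⨆ k, u k ^ s :=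
    fun hs u => (ENNReal.orderIsoRpow _ hs).map_iSup u
  rw [lintegral_eq_iSup_lintegral_min_natCast_s9 hF, lintegral_eq_iSup_lintegral_min_natCast_s9 hG,
    hpow hl0, hpow h1, ENNReal.iSup_mul]
  refine iSup_le fun i => ?_
  rw [ENNReal.mul_iSup]
  refine iSup_le fun j => ?_
  refine Real.prekopaLeindler_of_iSup_ne_top hl0 hl1 (hF.min measurable_const)
    (hG.min measurable_const) hH (hsup F i) (hsup G j) fun x y => le_trans ?_ (h x y)
  gcongr <;> exact min_le_left _ _

theorem prekopaLeindler_pi {l : ℝ} (hl0 : 0 < l) (hl1 : l < 1) (m : ℕ) :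
    PrekopaLeindler l (volume : Measure (Fin m → ℝ)) := by
  induction m with
  | zero =>
    intro F G H _ _ _ h
    have hv : (volume : Measure (Fin 0 → ℝ)) Set.univ = 1 := by simp [volume_pi]
    simp only [lintegral_unique, hv, mul_one]
    convert h default default
  | succ m ih =>
    let e : ℝ × (Fin m → ℝ) →ₗ[ℝ] (Fin (m + 1) → ℝ) :=
      { toFun := fun p => Fin.cons p.1 p.2
        map_add' := fun p q => by
          ext i
          refine Fin.cases ?_ (fun j => ?_) i <;> simp
        map_smul' := fun c p => by
          ext i
          refine Fin.cases ?_ (fun j => ?_) i <;> simp }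
    refine ((Real.prekopaLeindler hl0 hl1).prod ih).of_linearEquiv e ?_
    have he : ⇑e = (MeasurableEquiv.piFinSuccAbove (fun _ : Fin (m + 1) => ℝ) 0).symm := by
      ext p i
      simp [e, MeasurableEquiv.piFinSuccAbove, Fin.insertNthEquiv]
    rw [he]
    exact (volume_preserving_piFinSuccAbove (fun _ : Fin (m + 1) => ℝ) 0).symm


/-- For `f : ℝⁿ × ℝᵐ → [0,∞)` log-concave, bounded and measurable
(with finite fiber integrals), the marginal `g(x) = ∫ f(x,y) dy` is log-concave. -/
theorem stmt9 {n m : ℕ} (f : (Fin n → ℝ) × (Fin m → ℝ) → ℝ)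
    (hf0 : ∀ z, 0 ≤ f z)
    (hflc : ∀ z₁ z₂ : (Fin n → ℝ) × (Fin m → ℝ), ∀ l : ℝ, 0 ≤ l → l ≤ 1 →
      f (l • z₁ + (1 - l) • z₂) ≥ f z₁ ^ l * f z₂ ^ (1 - l))
    (hfb : ∃ M : ℝ, ∀ z, f z ≤ M) (hfm : Measurable f)
    (hint : ∀ x : Fin n → ℝ, Integrable (fun y : Fin m → ℝ => f (x, y)))
    (g : (Fin n → ℝ) → ℝ)
    (hg : g = fun x => ∫ y : Fin m → ℝ, f (x, y))
    (x₁ x₂ : Fin n → ℝ) (l : ℝ) (hl0 : 0 ≤ l) (hl1 : l ≤ 1) :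
    g (l • x₁ + (1 - l) • x₂) ≥ g x₁ ^ l * g x₂ ^ (1 - l) := by
  subst hg
  rcases hl0.eq_or_lt with rfl | hl0
  · simp
  rcases hl1.eq_or_lt with rfl | hl1
  · simp
  have h1 : 0 < 1 - l := sub_pos.2 hl1
  have hm : ∀ x, Measurable fun y : Fin m → ℝ => ENNReal.ofReal (f (x, y)) := fun x =>
    (hfm.comp measurable_prodMk_left).ennreal_ofReal
  have hg : ∀ x, ∫⁻ y : Fin m → ℝ, ENNReal.ofReal (f (x, y)) =
      ENNReal.ofReal (∫ y : Fin m → ℝ, f (x, y)) := fun x =>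
    (ofReal_integral_eq_lintegral_ofReal (hint x) (.of_forall fun y => hf0 _)).symm
  have hg0 : ∀ x, 0 ≤ ∫ y : Fin m → ℝ, f (x, y) := fun x => integral_nonneg fun y => hf0 _
  have key := prekopaLeindler_pi hl0 hl1 m _ _ _ (hm x₁) (hm x₂) (hm (l • x₁ + (1 - l) • x₂))
    (fun y z => by
      rw [ENNReal.ofReal_rpow_of_nonneg (hf0 _) hl0.le, ENNReal.ofReal_rpow_of_nonneg (hf0 _) h1.le,
        ← ENNReal.ofReal_mul (Real.rpow_nonneg (hf0 _) _)]
      exact ENNReal.ofReal_le_ofReal (hflc (x₁, y) (x₂, z) l hl0.le hl1.le))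
  rw [hg, hg, hg, ENNReal.ofReal_rpow_of_nonneg (hg0 _) hl0.le,
    ENNReal.ofReal_rpow_of_nonneg (hg0 _) h1.le, ← ENNReal.ofReal_mul (Real.rpow_nonneg (hg0 _) _),
    ENNReal.ofReal_le_ofReal_iff (hg0 _)] at key
  exact key
end

section
/- Let μ ∈ ℝⁿ, C ∈ ℝⁿˣⁿ symmetric positive definite, U ∈ ℝ^{l×n} (l ≤ n) of full row rank, t : ℝˡ → [0,∞) measurable, and Z = ∫ t(Ux) N(x;μ,C) dx ∈ (0,∞). Assume the tilted distributions below have finite second moments. Then the covariance C* of the density Z⁻¹ t(Ux) N(x;μ,C) on ℝⁿ satisfies C* = C + CUᵗ(UCUᵗ)⁻¹(C̄ − UCUᵗ)(UCUᵗ)⁻¹UC, where C̄ ∈ ℝˡˣˡ is the covariance of the density Z⁻¹ t(s) N(s;Uμ,UCUᵗ) on ℝˡ. -/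
open MeasureTheory Matrix

open MeasureTheory

open ProbabilityTheory

theorem pi_gaussianReal_eq_withDensity {ι : Type} [Fintype ι] :
    Measure.pi (fun _ : ι => gaussianReal 0 1) =
      volume.withDensity fun z : ι → ℝ => ENNReal.ofReal (∏ i, gaussianPDFReal 0 1 (z i)) := by
  refine Measure.pi_eq fun s hs => ?_
  rw [withDensity_apply _ (MeasurableSet.univ_pi hs), ← ofReal_integral_eq_lintegral_ofReal]
  · have h (z : ι → ℝ) : (Set.univ.pi s).indicator (fun z => ∏ i, gaussianPDFReal 0 1 (z i)) z =
        ∏ i, (s i).indicator (gaussianPDFReal 0 1) (z i) := by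
      by_cases hz : z ∈ Set.univ.pi s
      · rw [Set.indicator_of_mem hz]
        exact Finset.prod_congr rfl fun i _ => by rw [Set.indicator_of_mem (hz i trivial)]
      · rw [Set.indicator_of_notMem hz]
        obtain ⟨i, hi⟩ : ∃ i, z i ∉ s i := by simpa using hz
        exact (Finset.prod_eq_zero (Finset.mem_univ i) (Set.indicator_of_notMem hi _)).symm
    rw [← integral_indicator (MeasurableSet.univ_pi hs)]
    simp_rw [h, integral_fintype_prod_volume_eq_prod
      (fun i => (s i).indicator (gaussianPDFReal 0 1))]
    rw [ENNReal.ofReal_prod_of_nonneg]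
    · refine Finset.prod_congr rfl fun i _ => ?_
      rw [gaussianReal_apply_eq_integral _ one_ne_zero, integral_indicator (hs i)]
    · exact fun i _ => integral_nonneg fun x =>
        Set.indicator_nonneg (fun x _ => gaussianPDFReal_nonneg 0 1 x) x
  · exact (Integrable.fintype_prod fun i => integrable_gaussianPDFReal 0 1).restrict
  · exact .of_forall fun z => Finset.prod_nonneg fun i _ => gaussianPDFReal_nonneg _ _ _

theorem continuous_gaussianD_s13 {ι : Type} [Fintype ι] [DecidableEq ι]
    (μ : ι → ℝ) (C : Matrix ι ι ℝ) : Continuous (gaussianD μ C) := by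
  unfold gaussianD
  fun_prop

theorem gaussianD_nonneg_s13 {ι : Type} [Fintype ι] [DecidableEq ι]
    (μ : ι → ℝ) {C : Matrix ι ι ℝ} (hC : 0 ≤ C.det) (x : ι → ℝ) : 0 ≤ gaussianD μ C x := by
  unfold gaussianD
  positivity

theorem abs_det_mul_gaussianD {ι : Type} [Fintype ι] [DecidableEq ι]
    (μ : ι → ℝ) {A : Matrix ι ι ℝ} (hA : A.det ≠ 0) (z : ι → ℝ) :
    |A.det| * gaussianD μ (A * Aᵀ) (μ + A *ᵥ z) = ∏ i, gaussianPDFReal 0 1 (z i) := by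
  have hquad : (A *ᵥ z) ⬝ᵥ ((A * Aᵀ)⁻¹ *ᵥ (A *ᵥ z)) = ∑ i, z i ^ 2 := by
    have hu : IsUnit A.det := hA.isUnit
    rw [Matrix.mul_inv_rev, mulVec_mulVec, Matrix.mul_assoc, nonsing_inv_mul _ hu, Matrix.mul_one,
      dotProduct_mulVec, vecMul_mulVec, ← transpose_nonsing_inv, ← transpose_mul,
      nonsing_inv_mul _ hu]
    simp [dotProduct, sq]
  have hdet : |A.det| * (A * Aᵀ).det ^ (-(1 : ℝ) / 2) = 1 := by
    rw [det_mul, det_transpose, ← sq, ← sq_abs, ← Real.rpow_natCast,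
      ← Real.rpow_mul (abs_nonneg _)]
    norm_num
    rw [Real.rpow_neg_one, mul_inv_cancel₀ (abs_ne_zero.2 hA)]
  have hpi : (2 * Real.pi) ^ (-(Fintype.card ι : ℝ) / 2) =
      ∏ _i : ι, (√(2 * Real.pi))⁻¹ := by
    rw [Finset.prod_const, Finset.card_univ, Real.sqrt_eq_rpow, ← Real.rpow_neg (by positivity),
      ← Real.rpow_natCast, ← Real.rpow_mul (by positivity)]
    congr 1
    ring
  rw [gaussianD, add_sub_cancel_left, hquad, mul_comm ((2 * Real.pi) ^ _), mul_assoc,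
    ← mul_assoc, hdet, one_mul, hpi, Finset.mul_sum, Real.exp_sum, ← Finset.prod_mul_distrib]
  refine Finset.prod_congr rfl fun i _ => ?_
  simp only [gaussianPDFReal, NNReal.coe_one, mul_one, sub_zero]
  congr 2
  ring

theorem map_pi_gaussianReal_eq_withDensity {ι : Type} [Fintype ι] [DecidableEq ι]
    (μ : ι → ℝ) {A : Matrix ι ι ℝ} (hA : A.det ≠ 0) :
    (Measure.pi fun _ : ι => gaussianReal 0 1).map (fun z => μ + A *ᵥ z) =
      volume.withDensity fun x => ENNReal.ofReal (gaussianD μ (A * Aᵀ) x) := by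
  have hf : Measurable fun z : ι → ℝ => μ + A *ᵥ z := by fun_prop
  have hD := (continuous_gaussianD_s13 μ (A * Aᵀ)).measurable.ennreal_ofReal
  have hpdf : Measurable fun z : ι → ℝ => ENNReal.ofReal (∏ i, gaussianPDFReal 0 1 (z i)) := by
    fun_prop
  refine Measure.ext_of_lintegral _ fun g hg => ?_
  have hvol : (volume : Measure (ι → ℝ)) =
      ENNReal.ofReal |A.det| • volume.map (fun z : ι → ℝ => μ + A *ᵥ z) := by
    have h1 : (fun z : ι → ℝ => μ + A *ᵥ z) = (fun x => μ + x) ∘ toLin' A := rfl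
    rw [h1, ← Measure.map_map (by fun_prop) (toLin' A).continuous_of_finiteDimensional.measurable,
      Real.map_matrix_volume_pi_eq_smul_volume_pi hA, Measure.map_smul, map_add_left_eq_self,
      smul_smul, ← ENNReal.ofReal_mul (abs_nonneg _), ← abs_mul, mul_inv_cancel₀ hA]
    simp
  rw [lintegral_map hg hf, pi_gaussianReal_eq_withDensity,
    lintegral_withDensity_eq_lintegral_mul _ hpdf (g := fun z => g (μ + A *ᵥ z)) (hg.comp hf),
    lintegral_withDensity_eq_lintegral_mul _ hD hg]
  conv_rhs => rw [hvol]
  rw [lintegral_smul_measure, lintegral_map (hD.mul hg) hf, smul_eq_mul,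
    ← lintegral_const_mul' _ _ ENNReal.ofReal_ne_top]
  refine lintegral_congr fun z => ?_
  simp only [Pi.mul_apply]
  rw [← mul_assoc, ← ENNReal.ofReal_mul (abs_nonneg _), abs_det_mul_gaussianD μ hA]

open scoped MatrixOrder in
theorem map_ofLp_multivariateGaussian {ι : Type} [Fintype ι] [DecidableEq ι]
    (μ : ι → ℝ) {C : Matrix ι ι ℝ} (hC : C.PosDef) :
    (multivariateGaussian (WithLp.toLp 2 μ) C).map WithLp.ofLp =
      volume.withDensity fun x => ENNReal.ofReal (gaussianD μ C x) := by
  have hsq : CFC.sqrt C * CFC.sqrt C = C := CFC.sqrt_mul_sqrt_self C hC.posSemidef.nonneg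
  have hT : (CFC.sqrt C)ᵀ = CFC.sqrt C := by
    have h := (CFC.sqrt_nonneg C).isSelfAdjoint.star_eq
    rwa [star_eq_conjTranspose, conjTranspose_eq_transpose_of_trivial] at h
  have hdet : (CFC.sqrt C).det ≠ 0 := fun h => hC.det_pos.ne' (by rw [← hsq, det_mul, h, zero_mul])
  have h := map_pi_gaussianReal_eq_withDensity μ hdet
  rw [hT, hsq] at h
  rw [← h, multivariateGaussian, ← map_pi_eq_stdGaussian,
    Measure.map_map (by fun_prop) (by fun_prop), Measure.map_map (by fun_prop) (by fun_prop)]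
  rfl

theorem multivariateGaussian_map_mulVec {ι κ : Type} [Fintype ι] [DecidableEq ι] [Fintype κ]
    [DecidableEq κ] (μ : ι → ℝ) {C : Matrix ι ι ℝ} (hC : C.PosSemidef) (U : Matrix κ ι ℝ) :
    (multivariateGaussian (WithLp.toLp 2 μ) C).map (fun x => WithLp.toLp 2 (U *ᵥ x.ofLp)) =
      multivariateGaussian (WithLp.toLp 2 (U *ᵥ μ)) (U * C * Uᵀ) := by
  have hS : (U * C * Uᵀ).PosSemidef := by
    simpa [conjTranspose_eq_transpose_of_trivial] using hC.mul_mul_conjTranspose_same U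
  have hin (t : EuclideanSpace ℝ κ) (x : ι → ℝ) :
      inner ℝ (WithLp.toLp 2 (U *ᵥ x)) t =
        inner ℝ (WithLp.toLp 2 x) (WithLp.toLp 2 (Uᵀ *ᵥ t.ofLp)) := by
    simp only [EuclideanSpace.inner_eq_star_dotProduct, star_trivial]
    rw [dotProduct_mulVec, ← mulVec_transpose]
  refine Measure.ext_of_charFun (funext fun t => ?_)
  rw [charFun_apply, integral_map (by fun_prop) (by fun_prop)]
  simp_rw [hin]
  have h := charFun_multivariateGaussian (μ := WithLp.toLp 2 μ) hC (WithLp.toLp 2 (Uᵀ *ᵥ t.ofLp))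
  rw [charFun_apply] at h
  refine h.trans ?_
  rw [charFun_multivariateGaussian hS, real_inner_comm, ← hin, real_inner_comm]
  congr 4
  simp only
  rw [← mulVec_mulVec, ← mulVec_mulVec, dotProduct_mulVec t.ofLp U, mulVec_transpose]

theorem covariance_mulVec_multivariateGaussian {ι κ κ' : Type} [Fintype ι] [DecidableEq ι]
    (μ : EuclideanSpace ℝ ι) {C : Matrix ι ι ℝ} (hC : C.PosSemidef)
    (A : Matrix κ ι ℝ) (B : Matrix κ' ι ℝ) (i : κ) (j : κ') :
    cov[fun x => (A *ᵥ x.ofLp) i, fun x => (B *ᵥ x.ofLp) j; multivariateGaussian μ C] =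
      (A * C * Bᵀ) i j := by
  have hL (k : ι) : MemLp (fun x : EuclideanSpace ℝ ι => x k) 2 (multivariateGaussian μ C) :=
    (IsGaussian.hasGaussianLaw_id.map (EuclideanSpace.proj k)).memLp_two
  simp only [mulVec, dotProduct]
  rw [covariance_fun_sum_fun_sum (fun k => (hL k).const_mul _) (fun k => (hL k).const_mul _)]
  simp_rw [covariance_const_mul_left, covariance_const_mul_right,
    covariance_eval_multivariateGaussian hC, mul_apply, Finset.sum_mul, transpose_apply]
  rw [Finset.sum_comm]
  exact Finset.sum_congr rfl fun _ _ => Finset.sum_congr rfl fun _ _ => by ring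

theorem indepFun_mulVec_multivariateGaussian {ι κ κ' : Type} [Fintype ι] [DecidableEq ι]
    [Fintype κ] [Fintype κ']
    (μ : EuclideanSpace ℝ ι) {C : Matrix ι ι ℝ} (hC : C.PosSemidef)
    {A : Matrix κ ι ℝ} {B : Matrix κ' ι ℝ} (hAB : A * C * Bᵀ = 0) :
    IndepFun (fun x : EuclideanSpace ℝ ι => A *ᵥ x.ofLp) (fun x => B *ᵥ x.ofLp)
      (multivariateGaussian μ C) := by
  let e := (EuclideanSpace.equiv ι ℝ).toContinuousLinearMap
  have hL : HasGaussianLaw (fun x : EuclideanSpace ℝ ι => (A *ᵥ x.ofLp, B *ᵥ x.ofLp))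
      (multivariateGaussian μ C) :=
    IsGaussian.hasGaussianLaw_id.map
      (((toLin' A).toContinuousLinearMap ∘L e).prod ((toLin' B).toContinuousLinearMap ∘L e))
  refine HasGaussianLaw.indepFun_of_covariance_eval
    (X := fun i (x : EuclideanSpace ℝ ι) => (A *ᵥ x.ofLp) i)
    (Y := fun j (x : EuclideanSpace ℝ ι) => (B *ᵥ x.ofLp) j) hL fun i j => ?_
  rw [covariance_mulVec_multivariateGaussian μ hC, hAB, Matrix.zero_apply]

theorem integral_mul_gaussianD {ι : Type} [Fintype ι] [DecidableEq ι]
    (μ : ι → ℝ) {C : Matrix ι ι ℝ} (hC : C.PosDef) {f : (ι → ℝ) → ℝ} (hf : Measurable f) :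
    ∫ x, f x * gaussianD μ C x =
      ∫ x, f x.ofLp ∂(multivariateGaussian (WithLp.toLp 2 μ) C) := by
  have hD := (continuous_gaussianD_s13 μ C).measurable.ennreal_ofReal
  rw [← integral_map (φ := WithLp.ofLp) (by fun_prop) hf.aestronglyMeasurable,
    map_ofLp_multivariateGaussian μ hC,
    integral_withDensity_eq_integral_toReal_smul hD (.of_forall fun _ => ENNReal.ofReal_lt_top)]
  simp_rw [ENNReal.toReal_ofReal (gaussianD_nonneg_s13 μ hC.det_pos.le _), smul_eq_mul, mul_comm]

theorem integrable_mul_gaussianD_iff {ι : Type} [Fintype ι] [DecidableEq ι]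
    (μ : ι → ℝ) {C : Matrix ι ι ℝ} (hC : C.PosDef) {f : (ι → ℝ) → ℝ} (hf : Measurable f) :
    Integrable (fun x => f x * gaussianD μ C x) ↔
      Integrable (fun x => f x.ofLp) (multivariateGaussian (WithLp.toLp 2 μ) C) := by
  have hD := (continuous_gaussianD_s13 μ C).measurable.ennreal_ofReal
  have h := integrable_map_measure (f := WithLp.ofLp) (g := f)
    (μ := multivariateGaussian (WithLp.toLp 2 μ) C) hf.aestronglyMeasurable (by fun_prop)
  rw [Function.comp_def] at h
  rw [← h, map_ofLp_multivariateGaussian μ hC,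
    integrable_withDensity_iff_integrable_smul' hD (.of_forall fun _ => ENNReal.ofReal_lt_top)]
  simp_rw [ENNReal.toReal_ofReal (gaussianD_nonneg_s13 μ hC.det_pos.le _), smul_eq_mul, mul_comm]

section Projection

variable {ι κ : Type} [Fintype ι] [DecidableEq ι] [Fintype κ] [DecidableEq κ]
    (μ : ι → ℝ) {C : Matrix ι ι ℝ} {U : Matrix κ ι ℝ} {f : (κ → ℝ) → ℝ}

theorem integral_mul_gaussianD_mulVec (hC : C.PosDef) (hS : (U * C * Uᵀ).PosDef)
    (hf : Measurable f) :
    ∫ s, f s * gaussianD (U *ᵥ μ) (U * C * Uᵀ) s =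
      ∫ x, f (U *ᵥ x.ofLp) ∂(multivariateGaussian (WithLp.toLp 2 μ) C) := by
  have hf' : Measurable fun x : EuclideanSpace ℝ κ => f x.ofLp := hf.comp (by fun_prop)
  rw [integral_mul_gaussianD _ hS hf, ← multivariateGaussian_map_mulVec μ hC.posSemidef,
    integral_map (by fun_prop) hf'.aestronglyMeasurable]

theorem integrable_mul_gaussianD_mulVec_iff (hC : C.PosDef) (hS : (U * C * Uᵀ).PosDef)
    (hf : Measurable f) :
    Integrable (fun s => f s * gaussianD (U *ᵥ μ) (U * C * Uᵀ) s) ↔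
      Integrable (fun x => f (U *ᵥ x.ofLp)) (multivariateGaussian (WithLp.toLp 2 μ) C) := by
  have hf' : Measurable fun x : EuclideanSpace ℝ κ => f x.ofLp := hf.comp (by fun_prop)
  rw [integrable_mul_gaussianD_iff _ hS hf, ← multivariateGaussian_map_mulVec μ hC.posSemidef,
    integrable_map_measure hf'.aestronglyMeasurable (by fun_prop)]
  rfl

end Projection

section IndependentNoise

variable {Ω ι κ : Type} [MeasurableSpace Ω] {P : Measure Ω}
  [Fintype κ] {S : Ω → κ → ℝ} {R : Ω → ι → ℝ} {w : (κ → ℝ) → ℝ} {a : κ → ℝ}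

theorem integral_weight_mul_noise_add_mulVec (hSR : IndepFun S R P)
    (hR : ∀ i, Integrable (fun ω => R ω i) P) (hR0 : ∀ i, ∫ ω, R ω i ∂P = 0)
    (hw : Measurable w) (hw0 : Integrable (fun ω => w (S ω)) P)
    (hw1 : ∀ k, Integrable (fun ω => w (S ω) * (S ω - a) k) P)
    (K : Matrix ι κ ℝ) (i : ι) :
    ∫ ω, w (S ω) * (R ω + K *ᵥ (S ω - a)) i ∂P =
      ∑ k, K i k * ∫ ω, w (S ω) * (S ω - a) k ∂P := by
  have hind : IndepFun (fun ω => w (S ω)) (fun ω => R ω i) P :=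
    hSR.comp hw (measurable_pi_apply i)
  have hK (k : κ) : Integrable (fun ω => K i k * (w (S ω) * (S ω - a) k)) P :=
    (hw1 k).const_mul _
  have hwR : Integrable (fun ω => w (S ω) * R ω i) P := hind.integrable_mul hw0 (hR i)
  have h (ω : Ω) : w (S ω) * (R ω + K *ᵥ (S ω - a)) i =
      w (S ω) * R ω i + ∑ k, K i k * (w (S ω) * (S ω - a) k) := by
    simp only [Pi.add_apply, mulVec, dotProduct, mul_add, Finset.mul_sum, mul_left_comm]
  simp_rw [h]
  rw [integral_add hwR (integrable_finsetSum _ fun k _ => hK k),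
    integral_finsetSum _ fun k _ => hK k,
    hind.integral_fun_mul_eq_mul_integral hw0.aestronglyMeasurable (hR i).aestronglyMeasurable,
    hR0, mul_zero, zero_add]
  simp_rw [integral_const_mul]

theorem integral_weight_mul_noise_add_mulVec_mul [IsFiniteMeasure P] (hSR : IndepFun S R P)
    (hR : ∀ i, MemLp (fun ω => R ω i) 2 P) (hR0 : ∀ i, ∫ ω, R ω i ∂P = 0)
    (hw : Measurable w) (hw0 : Integrable (fun ω => w (S ω)) P)
    (hw1 : ∀ k, Integrable (fun ω => w (S ω) * (S ω - a) k) P)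
    (hw2 : ∀ k l, Integrable (fun ω => w (S ω) * ((S ω - a) k * (S ω - a) l)) P)
    (K : Matrix ι κ ℝ) (i j : ι) :
    ∫ ω, w (S ω) * ((R ω + K *ᵥ (S ω - a)) i * (R ω + K *ᵥ (S ω - a)) j) ∂P =
      (∫ ω, w (S ω) ∂P) * ∫ ω, R ω i * R ω j ∂P +
        (K * (Matrix.of fun k l => ∫ ω, w (S ω) * ((S ω - a) k * (S ω - a) l) ∂P) * Kᵀ) i j := by
  have hRi (i : ι) : Integrable (fun ω => R ω i) P := (hR i).integrable one_le_two
  have hRR : Integrable (fun ω => R ω i * R ω j) P := (hR i).integrable_mul (hR j)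
  have hindRR : IndepFun (fun ω => w (S ω)) (fun ω => R ω i * R ω j) P :=
    hSR.comp hw ((measurable_pi_apply i).mul (measurable_pi_apply j))
  have hindR (k : κ) (m : ι) : IndepFun (fun ω => w (S ω) * (S ω - a) k) (fun ω => R ω m) P :=
    hSR.comp (φ := fun s => w s * (s - a) k) (by fun_prop) (measurable_pi_apply m)
  have hcross (k : κ) (m : ι) : ∫ ω, w (S ω) * (S ω - a) k * R ω m ∂P = 0 := by
    rw [(hindR k m).integral_fun_mul_eq_mul_integral (hw1 k).aestronglyMeasurable
      (hRi m).aestronglyMeasurable, hR0, mul_zero]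
  have hint (m m' : ι) (k : κ) :
      Integrable (fun ω => K m k * (w (S ω) * (S ω - a) k * R ω m')) P :=
    ((hindR k m').integrable_mul (hw1 k) (hRi m')).const_mul _
  have h (ω : Ω) : w (S ω) * ((R ω + K *ᵥ (S ω - a)) i * (R ω + K *ᵥ (S ω - a)) j) =
      w (S ω) * (R ω i * R ω j) + ∑ k, K j k * (w (S ω) * (S ω - a) k * R ω i) +
        ∑ k, K i k * (w (S ω) * (S ω - a) k * R ω j) +
        ∑ l, ∑ k, K i k * K j l * (w (S ω) * ((S ω - a) k * (S ω - a) l)) := by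
    have h1 (m m' : ι) : ∑ k, K m k * (w (S ω) * (S ω - a) k * R ω m') =
        w (S ω) * R ω m' * (K *ᵥ (S ω - a)) m := by
      simp only [mulVec, dotProduct, Finset.mul_sum]
      exact Finset.sum_congr rfl fun _ _ => by ring
    have h2 : ∑ l, ∑ k, K i k * K j l * (w (S ω) * ((S ω - a) k * (S ω - a) l)) =
        w (S ω) * ((K *ᵥ (S ω - a)) i * (K *ᵥ (S ω - a)) j) := by
      simp only [mulVec, dotProduct]
      rw [Finset.sum_mul_sum, Finset.mul_sum, Finset.sum_comm]
      simp only [Finset.mul_sum]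
      exact Finset.sum_congr rfl fun _ _ => Finset.sum_congr rfl fun _ _ => by ring
    rw [h1, h1, h2]
    simp only [Pi.add_apply]
    ring
  have i1 : Integrable (fun ω => w (S ω) * (R ω i * R ω j)) P := hindRR.integrable_mul hw0 hRR
  have i2 (m m' : ι) : Integrable (fun ω => ∑ k, K m k * (w (S ω) * (S ω - a) k * R ω m')) P :=
    integrable_finsetSum _ fun k _ => hint m m' k
  have i3 (l k : κ) :
      Integrable (fun ω => K i k * K j l * (w (S ω) * ((S ω - a) k * (S ω - a) l))) P :=
    (hw2 k l).const_mul _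
  have i4 (l : κ) :
      Integrable (fun ω => ∑ k, K i k * K j l * (w (S ω) * ((S ω - a) k * (S ω - a) l))) P :=
    integrable_finsetSum _ fun k _ => i3 l k
  simp_rw [h]
  rw [integral_add (by fun_prop) (integrable_finsetSum _ fun l _ => i4 l),
    integral_add (by fun_prop) (i2 i j), integral_add i1 (i2 j i),
    integral_finsetSum _ fun k _ => hint j i k, integral_finsetSum _ fun k _ => hint i j k,
    integral_finsetSum _ fun l _ => i4 l,
    hindRR.integral_fun_mul_eq_mul_integral hw0.aestronglyMeasurable hRR.aestronglyMeasurable]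
  simp_rw [integral_finsetSum _ fun k _ => i3 _ k, integral_const_mul, hcross, mul_zero,
    Finset.sum_const_zero, add_zero, mul_apply, of_apply, Finset.sum_mul, transpose_apply]
  congr 1
  exact Finset.sum_congr rfl fun _ _ => Finset.sum_congr rfl fun _ _ => by ring

end IndependentNoise

theorem posDef_mul_mul_transpose_of_rank_eq {l n : ℕ} {C : Matrix (Fin n) (Fin n) ℝ}
    (hC : C.PosDef) {U : Matrix (Fin l) (Fin n) ℝ} (hU : U.rank = l) : (U * C * Uᵀ).PosDef := by
  have h : LinearIndependent ℝ U.row := by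
    rw [linearIndependent_iff_card_eq_finrank_span, Set.finrank, ← rank_eq_finrank_span_row, hU,
      Fintype.card_fin]
  simpa [conjTranspose_eq_transpose_of_trivial] using
    hC.mul_mul_conjTranspose_same (vecMul_injective_iff.2 h)

section AffineImage

variable {ι κ : Type} [Fintype ι] [DecidableEq ι]
  (μ : ι → ℝ) {C : Matrix ι ι ℝ}

theorem integral_mulVec_sub_multivariateGaussian (M : Matrix κ ι ℝ) (i : κ) :
    ∫ x, (M *ᵥ x.ofLp - M *ᵥ μ) i ∂(multivariateGaussian (WithLp.toLp 2 μ) C) = 0 := by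
  have hL (k : ι) : Integrable (fun x : EuclideanSpace ℝ ι => x k)
      (multivariateGaussian (WithLp.toLp 2 μ) C) :=
    (IsGaussian.hasGaussianLaw_id.map (EuclideanSpace.proj k)).integrable
  have hm (k : ι) :
      ∫ x : EuclideanSpace ℝ ι, x k ∂(multivariateGaussian (WithLp.toLp 2 μ) C) = μ k := by
    have h := (EuclideanSpace.proj (𝕜 := ℝ) k).integral_comp_comm
      (μ := multivariateGaussian (WithLp.toLp 2 μ) C) IsGaussian.integrable_fun_id
    simpa using h
  simp only [Pi.sub_apply, mulVec, dotProduct]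
  rw [integral_sub (integrable_finsetSum _ fun k _ => (hL k).const_mul _) (integrable_const _),
    integral_finsetSum _ fun k _ => (hL k).const_mul _]
  simp_rw [integral_const_mul, hm]
  simp

theorem memLp_mulVec_sub_multivariateGaussian (M : Matrix κ ι ℝ) (i : κ) :
    MemLp (fun x : EuclideanSpace ℝ ι => (M *ᵥ x.ofLp - M *ᵥ μ) i) 2
      (multivariateGaussian (WithLp.toLp 2 μ) C) := by
  have hL (k : ι) : MemLp (fun x : EuclideanSpace ℝ ι => x k) 2
      (multivariateGaussian (WithLp.toLp 2 μ) C) :=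
    (IsGaussian.hasGaussianLaw_id.map (EuclideanSpace.proj k)).memLp_two
  exact (memLp_finsetSum Finset.univ fun k _ => (hL k).const_mul (M i k)).sub (memLp_const _)

theorem integral_mulVec_sub_mul_multivariateGaussian (hC : C.PosSemidef)
    (M : Matrix κ ι ℝ) (i j : κ) :
    ∫ x, (M *ᵥ x.ofLp - M *ᵥ μ) i * (M *ᵥ x.ofLp - M *ᵥ μ) j
      ∂(multivariateGaussian (WithLp.toLp 2 μ) C) = (M * C * Mᵀ) i j := by
  have hi (i : κ) : ∫ x, (M *ᵥ x.ofLp) i ∂(multivariateGaussian (WithLp.toLp 2 μ) C) =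
      (M *ᵥ μ) i := by
    have h := integral_mulVec_sub_multivariateGaussian (C := C) μ M i
    have hint := ((memLp_mulVec_sub_multivariateGaussian (C := C) μ M i).add
      (memLp_const ((M *ᵥ μ) i))).integrable one_le_two
    simp only [Pi.sub_apply] at h
    rw [integral_sub (by convert! hint using 2; simp) (integrable_const _)] at h
    simpa [sub_eq_zero] using h
  rw [← covariance_mulVec_multivariateGaussian (WithLp.toLp 2 μ) hC, covariance]
  simp_rw [hi, Pi.sub_apply]

end AffineImage

/-- The covariance `C*` of the tilted density `Z⁻¹ t(Ux) N(x;μ,C)` on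
ℝⁿ satisfies `C* = C + CUᵗ(UCUᵗ)⁻¹(C̄ - UCUᵗ)(UCUᵗ)⁻¹UC`, where `C̄` is the
covariance of the density `Z⁻¹ t(s) N(s;Uμ,UCUᵗ)` on ℝˡ. -/
theorem stmt13 {l n : ℕ} (hln : l ≤ n) (μ : Fin n → ℝ)
    (C : Matrix (Fin n) (Fin n) ℝ) (hC : C.PosDef) (hCsymm : C.IsSymm)
    (U : Matrix (Fin l) (Fin n) ℝ) (hU : U.rank = l)
    (t : (Fin l → ℝ) → ℝ) (ht0 : ∀ s, 0 ≤ t s) (htm : Measurable t)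
    (Z : ℝ) (hZ : Z = ∫ x : Fin n → ℝ, t (U *ᵥ x) * gaussianD μ C x)
    (hZpos : 0 < Z)
    (p : (Fin n → ℝ) → ℝ)
    (hp : p = fun x => Z⁻¹ * (t (U *ᵥ x) * gaussianD μ C x))
    (q : (Fin l → ℝ) → ℝ)
    (hq : q = fun s => Z⁻¹ * (t s * gaussianD (U *ᵥ μ) (U * C * Uᵀ) s))
    (hm1 : Integrable (fun x : Fin n → ℝ => p x • x))
    (hm1' : Integrable (fun s : Fin l → ℝ => q s • s))
    (μstar : Fin n → ℝ) (hμstar : μstar = ∫ x : Fin n → ℝ, p x • x)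
    (sbar : Fin l → ℝ) (hsbar : sbar = ∫ s : Fin l → ℝ, q s • s)
    (hm2 : ∀ i j : Fin n,
      Integrable (fun x : Fin n → ℝ => p x * ((x - μstar) i * (x - μstar) j)))
    (hm2' : ∀ i j : Fin l,
      Integrable (fun s : Fin l → ℝ => q s * ((s - sbar) i * (s - sbar) j)))
    (Cstar : Matrix (Fin n) (Fin n) ℝ)
    (hCstar : Cstar = Matrix.of fun i j =>
      ∫ x : Fin n → ℝ, p x * ((x - μstar) i * (x - μstar) j))
    (Cbar : Matrix (Fin l) (Fin l) ℝ)
    (hCbar : Cbar = Matrix.of fun i j =>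
      ∫ s : Fin l → ℝ, q s * ((s - sbar) i * (s - sbar) j)) :
    Cstar = C + C * Uᵀ * (U * C * Uᵀ)⁻¹ * (Cbar - U * C * Uᵀ) * (U * C * Uᵀ)⁻¹ * U * C := by
  subst hp hq
  have hS := posDef_mul_mul_transpose_of_rank_eq hC hU
  have hdet : IsUnit (U * C * Uᵀ).det := hS.det_pos.ne'.isUnit
  have hSsymm : (U * C * Uᵀ)ᵀ = U * C * Uᵀ := by
    rw [transpose_mul, transpose_mul, transpose_transpose, hCsymm.eq, Matrix.mul_assoc]
  set P := multivariateGaussian (WithLp.toLp 2 μ) C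
  set K := C * Uᵀ * (U * C * Uᵀ)⁻¹ with hKdef
  have hK : K * (U * C * Uᵀ) = C * Uᵀ := by
    rw [hKdef, Matrix.mul_assoc, nonsing_inv_mul _ hdet, Matrix.mul_one]
  have hKt : Kᵀ = (U * C * Uᵀ)⁻¹ * U * C := by
    rw [hKdef, transpose_mul, transpose_mul, transpose_transpose, transpose_nonsing_inv, hSsymm,
      hCsymm.eq, ← Matrix.mul_assoc]
  obtain ⟨M, hM⟩ : ∃ M, M = 1 - K * U := ⟨_, rfl⟩
  have hMCU : M * C * Uᵀ = 0 := by
    rw [hM, Matrix.sub_mul, Matrix.sub_mul, Matrix.one_mul, Matrix.mul_assoc K,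
      Matrix.mul_assoc K, hK, sub_self]
  have hUCM : U * C * Mᵀ = 0 := by
    rw [← transpose_eq_zero, transpose_mul, transpose_mul, transpose_transpose, hCsymm.eq,
      ← Matrix.mul_assoc, hMCU]
  have hMCM : M * C * Mᵀ = C - K * U * C := by
    have hMt : Mᵀ = 1 - Uᵀ * Kᵀ := by rw [hM, transpose_sub, transpose_one, transpose_mul]
    rw [hMt, Matrix.mul_sub, Matrix.mul_one, ← Matrix.mul_assoc, hMCU, Matrix.zero_mul, sub_zero,
      hM, Matrix.sub_mul, Matrix.one_mul]
  set S : EuclideanSpace ℝ (Fin n) → Fin l → ℝ := fun x => U *ᵥ x.ofLp with hSdef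
  set R : EuclideanSpace ℝ (Fin n) → Fin n → ℝ := fun x => M *ᵥ x.ofLp - M *ᵥ μ with hRdef
  have hSR : IndepFun S R P :=
    (indepFun_mulVec_multivariateGaussian (WithLp.toLp 2 μ) hC.posSemidef hUCM).comp
      (ψ := fun y => y - M *ᵥ μ) measurable_id (by fun_prop)
  have hR := memLp_mulVec_sub_multivariateGaussian (C := C) μ M
  have hR0 := integral_mulVec_sub_multivariateGaussian (C := C) μ M
  set w : (Fin l → ℝ) → ℝ := fun s => Z⁻¹ * t s with hwdef
  have hwm : Measurable w := htm.const_mul _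
  have hw0 : Integrable (fun ω => w (S ω)) P := by
    have h : Integrable fun x => t (U *ᵥ x) * gaussianD μ C x :=
      not_imp_comm.1 integral_undef (hZ ▸ hZpos.ne')
    exact ((integrable_mul_gaussianD_iff μ hC (htm.comp (by fun_prop))).1 h).const_mul Z⁻¹
  have hw1 : ∫ ω, w (S ω) ∂P = 1 := by
    have h := integral_mul_gaussianD μ hC (f := fun x => t (U *ᵥ x)) (htm.comp (by fun_prop))
    rw [← hZ] at h
    simp_rw [hwdef, integral_const_mul]
    rw [← h, inv_mul_cancel₀ hZpos.ne']
  have hq (f : (Fin l → ℝ) → ℝ) :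
      (fun s => Z⁻¹ * (t s * gaussianD (U *ᵥ μ) (U * C * Uᵀ) s) * f s) =
        fun s => (w s * f s) * gaussianD (U *ᵥ μ) (U * C * Uᵀ) s := by
    funext s; simp only [hwdef]; ring
  have hp (f : (Fin n → ℝ) → ℝ) :
      (fun x => Z⁻¹ * (t (U *ᵥ x) * gaussianD μ C x) * f x) =
        fun x => (w (U *ᵥ x) * f x) * gaussianD μ C x := by
    funext x; simp only [hwdef]; ring
  have hwS (k : Fin l) : Integrable (fun ω => w (S ω) * S ω k) P := by
    have h := hm1'.eval k
    simp only [Pi.smul_apply, smul_eq_mul] at h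
    rw [hq fun s => s k] at h
    exact (integrable_mul_gaussianD_mulVec_iff μ hC hS (by fun_prop)).1 h
  have hsbar_apply (k : Fin l) : ∫ ω, w (S ω) * S ω k ∂P = sbar k := by
    rw [hsbar, eval_integral fun k => hm1'.eval k]
    simp only [Pi.smul_apply, smul_eq_mul]
    rw [hq fun s => s k]
    exact (integral_mul_gaussianD_mulVec μ hC hS (f := fun s => w s * s k) (by fun_prop)).symm
  have hwD (k : Fin l) : Integrable (fun ω => w (S ω) * (S ω - sbar) k) P := by
    simp only [Pi.sub_apply, mul_sub]
    exact (hwS k).sub (hw0.mul_const _)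
  have hwD0 (k : Fin l) : ∫ ω, w (S ω) * (S ω - sbar) k ∂P = 0 := by
    simp only [Pi.sub_apply, mul_sub]
    rw [integral_sub (hwS k) (hw0.mul_const _), integral_mul_const, hw1, hsbar_apply, one_mul,
      sub_self]
  have hwDD (k m : Fin l) :
      Integrable (fun ω => w (S ω) * ((S ω - sbar) k * (S ω - sbar) m)) P := by
    have h := hm2' k m
    rw [hq fun s => (s - sbar) k * (s - sbar) m] at h
    exact (integrable_mul_gaussianD_mulVec_iff μ hC hS (by fun_prop)).1 h
  have hCbar' : Cbar = of fun k m => ∫ ω, w (S ω) * ((S ω - sbar) k * (S ω - sbar) m) ∂P := by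
    rw [hCbar]
    ext k m
    simp only [of_apply]
    rw [hq fun s => (s - sbar) k * (s - sbar) m]
    exact integral_mul_gaussianD_mulVec μ hC hS
      (f := fun s => w s * ((s - sbar) k * (s - sbar) m)) (by fun_prop)
  have hdecomp (ω : EuclideanSpace ℝ (Fin n)) :
      ω.ofLp = R ω + K *ᵥ (S ω - sbar) + (M *ᵥ μ + K *ᵥ sbar) := by
    simp only [hRdef, hSdef, hM, mulVec_sub, sub_mulVec, one_mulVec, mulVec_mulVec]
    abel
  have hμ : μstar = M *ᵥ μ + K *ᵥ sbar := by
    ext i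
    have hRi := (hR i).integrable one_le_two
    have hwX : Integrable (fun ω => w (S ω) * ω i) P := by
      have h := hm1.eval i
      simp only [Pi.smul_apply, smul_eq_mul] at h
      rw [hp fun x => x i] at h
      exact (integrable_mul_gaussianD_iff μ hC (by fun_prop)).1 h
    have h1 : ∫ ω, w (S ω) * (R ω + K *ᵥ (S ω - sbar)) i ∂P = 0 := by
      rw [integral_weight_mul_noise_add_mulVec hSR (fun i => (hR i).integrable one_le_two) hR0 hwm
        hw0 hwD K i]
      simp_rw [hwD0, mul_zero, Finset.sum_const_zero]
    have h2 (ω : EuclideanSpace ℝ (Fin n)) : w (S ω) * (R ω + K *ᵥ (S ω - sbar)) i =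
        w (S ω) * ω i - w (S ω) * (M *ᵥ μ + K *ᵥ sbar) i := by
      rw [← mul_sub]
      congr 1
      exact eq_sub_of_add_eq (congrFun (hdecomp ω) i).symm
    simp_rw [h2] at h1
    rw [integral_sub hwX (hw0.mul_const _), integral_mul_const, hw1, one_mul, sub_eq_zero] at h1
    rw [← h1, hμstar, eval_integral fun i => hm1.eval i]
    simp only [Pi.smul_apply, smul_eq_mul]
    rw [hp fun x => x i]
    exact integral_mul_gaussianD μ hC (f := fun x => w (U *ᵥ x) * x i) (by fun_prop)
  have hCstar' : Cstar = C - K * U * C + K * Cbar * Kᵀ := by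
    rw [hCstar]
    ext i j
    simp only [of_apply]
    rw [hp fun x => (x - μstar) i * (x - μstar) j]
    refine (integral_mul_gaussianD μ hC
      (f := fun x => w (U *ᵥ x) * ((x - μstar) i * (x - μstar) j)) (by fun_prop)).trans ?_
    have h (ω : EuclideanSpace ℝ (Fin n)) : ω.ofLp - μstar = R ω + K *ᵥ (S ω - sbar) := by
      rw [hμ]
      exact sub_eq_of_eq_add (hdecomp ω)
    simp_rw [h]
    have h' := integral_weight_mul_noise_add_mulVec_mul hSR hR hR0 hwm hw0 hwD hwDD K i j
    rw [hw1, one_mul] at h'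
    rw [Matrix.add_apply, hCbar', ← hMCM,
      ← integral_mulVec_sub_mul_multivariateGaussian μ hC.posSemidef]
    exact h'
  have hKSK : K * (U * C * Uᵀ) * Kᵀ = K * U * C := by
    rw [hK, hKt, hKdef]
    simp only [Matrix.mul_assoc]
  have hfactor : K * (Cbar - U * C * Uᵀ) * (U * C * Uᵀ)⁻¹ * U * C =
      K * (Cbar - U * C * Uᵀ) * Kᵀ := by
    simp only [hKt, Matrix.mul_assoc]
  rw [hCstar', hfactor, Matrix.mul_sub, Matrix.sub_mul, hKSK]
  abel
end

section
/- Let K ∈ ℝⁿˣⁿ be symmetric positive definite, U ∈ ℝ^{l×n} of full row rank, Kᵢ ∈ ℝˡˣˡ symmetric and invertible with K − UᵗKᵢU invertible and I − (UK⁻¹Uᵗ)Kᵢ invertible, and let h ∈ ℝⁿ, hᵢ ∈ ℝˡ. Then U (K − UᵗKᵢU)⁻¹ (h − Uᵗhᵢ) = (I − K̂ᵢKᵢ)⁻¹ (UK⁻¹h − K̂ᵢhᵢ), where K̂ᵢ = UK⁻¹Uᵗ. -/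
open MeasureTheory Matrix

/-- Cavity mean identity of projected EP (via the Woodbury identity):
`U(K - UᵗKᵢU)⁻¹(h - Uᵗhᵢ) = (I - K̂ᵢKᵢ)⁻¹(UK⁻¹h - K̂ᵢhᵢ)` with `K̂ᵢ = UK⁻¹Uᵗ`. -/
theorem stmt15 {l n : ℕ} (K : Matrix (Fin n) (Fin n) ℝ) (hK : K.PosDef) (hKsymm : K.IsSymm)
    (U : Matrix (Fin l) (Fin n) ℝ) (hU : U.rank = l)
    (Ki : Matrix (Fin l) (Fin l) ℝ) (hKi : Ki.IsSymm) (hKiInv : IsUnit Ki.det)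
    (h1 : IsUnit (K - Uᵀ * Ki * U).det)
    (h2 : IsUnit (1 - U * K⁻¹ * Uᵀ * Ki).det)
    (h : Fin n → ℝ) (hi : Fin l → ℝ) :
    U *ᵥ ((K - Uᵀ * Ki * U)⁻¹ *ᵥ (h - Uᵀ *ᵥ hi))
      = (1 - U * K⁻¹ * Uᵀ * Ki)⁻¹ *ᵥ (U *ᵥ (K⁻¹ *ᵥ h) - (U * K⁻¹ * Uᵀ) *ᵥ hi) := by
  have hKdet : IsUnit K.det := isUnit_iff_ne_zero.mpr hK.det_pos.ne'
  have push : (1 - U * K⁻¹ * Uᵀ * Ki) * U = U * K⁻¹ * (K - Uᵀ * Ki * U) := by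
    rw [Matrix.sub_mul, Matrix.one_mul, Matrix.mul_sub, nonsing_inv_mul_cancel_right _ _ hKdet]
    simp only [Matrix.mul_assoc]
  have inv_push : U * (K - Uᵀ * Ki * U)⁻¹ = (1 - U * K⁻¹ * Uᵀ * Ki)⁻¹ * (U * K⁻¹) := by
    rw [← nonsing_inv_mul_cancel_left _ (U * (K - Uᵀ * Ki * U)⁻¹) h2, ← Matrix.mul_assoc _ U,
      push, mul_nonsing_inv_cancel_right _ _ h1]
  have factor : U *ᵥ (K⁻¹ *ᵥ h) - (U * K⁻¹ * Uᵀ) *ᵥ hi = (U * K⁻¹) *ᵥ (h - Uᵀ *ᵥ hi) := by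
    simp only [mulVec_sub, mulVec_mulVec]
  rw [factor, mulVec_mulVec, mulVec_mulVec, inv_push]
end

section
/- Let C ∈ ℝⁿˣⁿ be symmetric positive definite, U ∈ ℝ^{l×n} of full row rank, Ĉ = UCUᵗ, V ∈ ℝˡˣˡ symmetric positive definite, μ ∈ ℝⁿ and s̄ ∈ ℝˡ. Define μ* = μ + CUᵗĈ⁻¹(s̄ − Uμ) and C* = C + CUᵗĈ⁻¹(V − Ĉ)Ĉ⁻¹UC, and assume C* is invertible. Then (C*)⁻¹μ* − C⁻¹μ = Uᵗ (V⁻¹ s̄ − Ĉ⁻¹ Uμ). -/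
open MeasureTheory Matrix

theorem Matrix.vecMul_injective_of_rank_eq_card {m n K : Type*} [Fintype m] [Fintype n] [Field K]
    {A : Matrix m n K} (hA : A.rank = Fintype.card m) : Function.Injective A.vecMul := by
  rw [vecMul_injective_iff, linearIndependent_iff_card_eq_finrank_span, ← hA,
    rank_eq_finrank_span_row, Set.finrank]

/-- Linear-parameter update of the Gaussian factor approximation in
projected EP: with `Ĉ = UCUᵗ`, `μ* = μ + CUᵗĈ⁻¹(s̄ - Uμ)` and
`C* = C + CUᵗĈ⁻¹(V - Ĉ)Ĉ⁻¹UC` invertible,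
`(C*)⁻¹μ* - C⁻¹μ = Uᵗ(V⁻¹s̄ - Ĉ⁻¹Uμ)`. -/
theorem stmt17 {l n : ℕ} (C : Matrix (Fin n) (Fin n) ℝ) (hC : C.PosDef) (hCsymm : C.IsSymm)
    (U : Matrix (Fin l) (Fin n) ℝ) (hU : U.rank = l)
    (V : Matrix (Fin l) (Fin l) ℝ) (hV : V.PosDef) (hVsymm : V.IsSymm)
    (Chat : Matrix (Fin l) (Fin l) ℝ) (hChat : Chat = U * C * Uᵀ)
    (μ : Fin n → ℝ) (sbar : Fin l → ℝ)
    (μstar : Fin n → ℝ)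
    (hμstar : μstar = μ + (C * Uᵀ * Chat⁻¹) *ᵥ (sbar - U *ᵥ μ))
    (Cstar : Matrix (Fin n) (Fin n) ℝ)
    (hCstar : Cstar = C + C * Uᵀ * Chat⁻¹ * (V - Chat) * Chat⁻¹ * U * C)
    (hCstarInv : IsUnit Cstar.det) :
    Cstar⁻¹ *ᵥ μstar - C⁻¹ *ᵥ μ = Uᵀ *ᵥ (V⁻¹ *ᵥ sbar - Chat⁻¹ *ᵥ (U *ᵥ μ)) := by
  have hChatUnit : IsUnit Chat.det := by
    rw [← isUnit_iff_isUnit_det, hChat, ← conjTranspose_eq_transpose_of_trivial]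
    exact (hC.mul_mul_conjTranspose_same
      (vecMul_injective_of_rank_eq_card (by simpa using hU))).isUnit
  have hCUnit : IsUnit C.det := (isUnit_iff_isUnit_det C).mp hC.isUnit
  have hVUnit : IsUnit V.det := (isUnit_iff_isUnit_det V).mp hV.isUnit
  have hCstarU : Cstar * Uᵀ = C * Uᵀ * Chat⁻¹ * V := by
    calc Cstar * Uᵀ = C * Uᵀ + C * Uᵀ * Chat⁻¹ * (V - Chat) * (Chat⁻¹ * (U * C * Uᵀ)) := by
          rw [hCstar]; simp only [Matrix.add_mul, Matrix.mul_assoc]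
      _ = C * Uᵀ * Chat⁻¹ * V := by
          rw [← hChat, nonsing_inv_mul _ hChatUnit, Matrix.mul_one, Matrix.mul_sub,
            nonsing_inv_mul_cancel_right _ _ hChatUnit, add_sub_cancel]
  have hCstarC : Cstar * C⁻¹ = 1 + C * Uᵀ * Chat⁻¹ * (V - Chat) * Chat⁻¹ * U := by
    rw [hCstar, Matrix.add_mul, mul_nonsing_inv _ hCUnit, mul_nonsing_inv_cancel_right _ _ hCUnit]
  have hμ : μstar =
      Cstar *ᵥ (C⁻¹ *ᵥ μ + Uᵀ *ᵥ (V⁻¹ *ᵥ sbar - Chat⁻¹ *ᵥ (U *ᵥ μ))) := by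
    rw [mulVec_add, mulVec_mulVec, mulVec_mulVec _ Cstar, hCstarC, hCstarU, hμstar, mulVec_sub,
      mulVec_sub, mulVec_mulVec _ _ V⁻¹, mul_nonsing_inv_cancel_right _ _ hVUnit, Matrix.mul_sub,
      nonsing_inv_mul_cancel_right _ _ hChatUnit, Matrix.sub_mul, Matrix.sub_mul, add_mulVec,
      sub_mulVec, one_mulVec]
    simp only [mulVec_mulVec, Matrix.mul_assoc]
    abel
  rw [hμ, mulVec_mulVec, nonsing_inv_mul _ hCstarInv, one_mulVec, add_sub_cancel_left]
end
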